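/- arXiv:2103.12391 — 2 statements merged into one kernel-verified Lean document; each statement's English description precedes it below -/
import Mathlib

section
/- Let K be an algebraically closed field, S a smooth connected K-curve, X a quasi-projective K-variety, and φ: X → S a surjective morphism such that every irreducible component of X dominates S and every fibre of φ is pure. Let D ⊆ X be a Zariski closed subset such that: (i) there exists a dense Zariski open U ⊆ S such that for every s ∈ U, every irreducible component of D ∩ X_s has codimension 1 in X_s; and (ii) D is the Zariski closure in X of its generic fibre D_η, where η is the generic point of S. Then for every s ∈ S, every irreducible component of D ∩ X_s has codimension 1 in X_s. -/
section Helpers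
open Cardinal
open Algebra (trdeg)
theorem trdeg_alg (k P B : Type) [Field k] [CommRing P] [CommRing B] [IsDomain P] [IsDomain B]
   [Algebra k P] [Algebra k B] [Algebra P B] [IsScalarTower k P B] [FaithfulSMul P B]
   [Algebra.IsAlgebraic P B] : Algebra.trdeg k P = Algebra.trdeg k B := by
  rw [← trdeg_add_eq k P (A := B), trdeg_eq_zero (R := P), add_zero]

theorem trdeg_lt (k B C : Type) [Field k] [CommRing B] [IsDomain B] [CommRing C] [IsDomain C]
    [Algebra k B] [Algebra k C] (hfin : Algebra.trdeg k B < ℵ₀) (f : B →ₐ[k] C)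
    (hf : Function.Surjective f) (b : B) (hb : b ≠ 0) (hfb : f b = 0) :
    Algebra.trdeg k C < Algebra.trdeg k B := by
  refine lt_of_le_of_ne (trdeg_le_of_surjective f hf) fun heq => ?_
  obtain ⟨s, hs⟩ := exists_isTranscendenceBasis k C
  have hcard := hs.cardinalMk_eq_trdeg
  have hsf : Finite s := by
    rw [← Cardinal.mk_lt_aleph0_iff, hcard, heq]; exact hfin
  choose g hg using hf
  let x : s → B := fun i => g i
  have hfx : f ∘ x = Subtype.val := funext fun i => hg _
  have hx : AlgebraicIndependent k x := by
    apply AlgebraicIndependent.of_comp f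
    rw [hfx]; exact hs.1
  have hx2 : IsTranscendenceBasis k x :=
    hx.isTranscendenceBasis_of_trdeg_le_of_finite (by rw [hcard, heq])
  have halg := hx2.isAlgebraic
  have h1 : IsAlgebraic (Algebra.adjoin k (Set.range x)) b := halg.isAlgebraic b
  have h2 := Ideal.comap_ne_bot_of_algebraic_mem (I := RingHom.ker f) hb hfb h1
  apply h2
  rw [eq_bot_iff]
  rintro ⟨a, ha⟩ hak
  have ha' := ha
  rw [Algebra.adjoin_range_eq_range_aeval] at ha'
  obtain ⟨p, rfl⟩ := ha'
  have h3 : f (MvPolynomial.aeval x p) = 0 := hak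
  rw [← AlgHom.comp_apply, MvPolynomial.comp_aeval] at h3
  have h4 := hs.1
  rw [← hfx] at h4
  have := (injective_iff_map_eq_zero _).1 h4 p h3
  subst this
  exact Subtype.ext (map_zero _)

theorem trdeg_mvpoly_quot (k : Type) [Field k] (n : ℕ) (π : MvPolynomial (Fin n) k) 
    (hπ : Prime π) : Algebra.trdeg k (MvPolynomial (Fin n) k ⧸ Ideal.span {π}) + 1 = n := by
  have hprime : (Ideal.span {π}).IsPrime := (Ideal.span_singleton_prime hπ.ne_zero).2 hπ
  have hn : trdeg k (MvPolynomial (Fin n) k) = n := by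
    rw [MvPolynomial.trdeg_of_isDomain]; simp
  have hlt := trdeg_lt k _ _ (by rw [hn]; exact Cardinal.natCast_lt_aleph0)
    (Ideal.Quotient.mkₐ k (Ideal.span {π})) Ideal.Quotient.mk_surjective
    π hπ.ne_zero (by simp)
  rw [hn] at hlt
  obtain ⟨m, hm⟩ := Cardinal.lt_aleph0.1 (hlt.trans Cardinal.natCast_lt_aleph0)
  rw [hm] at hlt ⊢
  have hmn : m < n := by exact_mod_cast hlt
  -- a variable
  have hv : ∃ i, MvPolynomial.degreeOf i π ≠ 0 := by
    by_contra! hcon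
    have : π.vars = ∅ := by
      ext i
      simp [MvPolynomial.mem_vars_iff_degreeOf_ne_zero, hcon i]
    rw [MvPolynomial.vars_eq_empty_iff_eq_C] at this
    have h0 : π.coeff 0 ≠ 0 := fun h => hπ.ne_zero (by rw [this, h, map_zero])
    exact hπ.not_isUnit (by rw [this]; exact (isUnit_iff_ne_zero.2 h0).map _)
  obtain ⟨i, hi⟩ := hv
  have hind : AlgebraicIndependent k (fun j : {j : Fin n // j ≠ i} => 
      Ideal.Quotient.mk (Ideal.span {π}) (MvPolynomial.X j.1)) := by
    rw [algebraicIndependent_iff]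
    intro p hp
    have h1 : Ideal.Quotient.mkₐ k (Ideal.span {π}) (MvPolynomial.rename Subtype.val p) = 0 := by
      rw [← hp, ← AlgHom.comp_apply]
      congr 1
      ext j
      simp
    have h2 : MvPolynomial.rename Subtype.val p ∈ Ideal.span {π} := 
      Ideal.Quotient.eq_zero_iff_mem.1 h1
    rw [Ideal.mem_span_singleton] at h2
    obtain ⟨c, hc⟩ := h2
    by_contra hp0
    have hr : MvPolynomial.rename (Subtype.val : {j : Fin n // j ≠ i} → Fin n) p ≠ 0 := 
      fun h => hp0 (MvPolynomial.rename_injective _ Subtype.val_injective (by simpa using h))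
    have hc0 : c ≠ 0 := by rintro rfl; simp [hr] at hc
    have := congrArg (MvPolynomial.degreeOf i) hc
    rw [MvPolynomial.degreeOf_mul_eq hπ.ne_zero hc0] at this
    have h0 : MvPolynomial.degreeOf i (MvPolynomial.rename (Subtype.val : {j : Fin n // j ≠ i} → Fin n) p) = 0 := by
      by_contra hne
      classical
      have h5 : i ∈ (MvPolynomial.rename (Subtype.val : {j : Fin n // j ≠ i} → Fin n) p).vars := by
        rw [MvPolynomial.mem_vars_iff_degreeOf_ne_zero]; exact hne
      have h6 := MvPolynomial.vars_rename _ _ h5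
      simp at h6
    omega
  have := hind.cardinalMk_le_trdeg
  rw [hm] at this
  simp at this
  have h7: n ≤ m + 1 := by exact_mod_cast this
  have : m + 1 = n := by omega
  exact_mod_cast this

theorem trdeg_height_one (k B : Type) [Field k] [CommRing B] [IsDomain B] [Algebra k B]
    [Algebra.FiniteType k B] (q : Ideal B) [q.IsPrime] (hq : q ≠ ⊥)
    (hq1 : ∀ Q : Ideal B, Q.IsPrime → Q < q → Q = ⊥) :
    trdeg k (B ⧸ q) + 1 = trdeg k B := by
  obtain ⟨n, g, hginj, hgint⟩ := exists_integral_inj_algHom_of_fg k B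
  algebraize [g.toRingHom]
  have hint : Algebra.IsIntegral (MvPolynomial (Fin n) k) B := ⟨hgint⟩
  have hsc : IsScalarTower k (MvPolynomial (Fin n) k) B := IsScalarTower.of_algHom g
  have hfs : FaithfulSMul (MvPolynomial (Fin n) k) B :=
    (faithfulSMul_iff_algebraMap_injective _ _).2 hginj
  have hn : trdeg k (MvPolynomial (Fin n) k) = n := by
    rw [MvPolynomial.trdeg_of_isDomain]; simp
  rw [← trdeg_alg k (MvPolynomial (Fin n) k) B, hn]
  have hq0 : q.under (MvPolynomial (Fin n) k) ≠ ⊥ := fun h =>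
    hq (Ideal.eq_bot_of_comap_eq_bot h)
  obtain ⟨π, hπq, hπ⟩ := Ideal.IsPrime.exists_mem_prime_of_ne_bot (inferInstance : (q.under (MvPolynomial (Fin n) k)).IsPrime) hq0
  have hprime : (Ideal.span {π}).IsPrime := (Ideal.span_singleton_prime hπ.ne_zero).2 hπ
  have hle : Ideal.span {π} ≤ q.under (MvPolynomial (Fin n) k) := by
    rwa [Ideal.span_singleton_le_iff_mem]
  have heq : Ideal.span {π} = q.under (MvPolynomial (Fin n) k) := by
    by_contra hne
    obtain ⟨Q, hQ, hQp, hQo⟩ := Ideal.exists_ideal_lt_liesOver_of_lt q (lt_of_le_of_ne hle hne)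
    have := hq1 Q hQp hQ
    subst this
    have h1 := hQo.over
    have : π ∈ (⊥ : Ideal B).under (MvPolynomial (Fin n) k) := h1 ▸ Ideal.mem_span_singleton_self π
    rw [Ideal.under, Ideal.mem_comap, Ideal.mem_bot] at this
    exact hπ.ne_zero (hginj (this.trans (map_zero g).symm))
  have hlo : q.LiesOver (Ideal.span {π}) := ⟨heq⟩
  rw [← trdeg_mvpoly_quot k n π hπ, trdeg_alg k (MvPolynomial (Fin n) k ⧸ Ideal.span {π}) (B ⧸ q)]

theorem trdeg_krull (k B : Type) [Field k] [CommRing B] [IsDomain B] [Algebra k B]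
    [Algebra.FiniteType k B] (t : B) (ht : t ≠ 0) (q : Ideal B)
    (hq : q ∈ (Ideal.span {t}).minimalPrimes) :
    trdeg k (B ⧸ q) + 1 = trdeg k B := by
  have := Algebra.FiniteType.isNoetherianRing k B
  have hqp : q.IsPrime := hq.1.1
  have htq : t ∈ q := hq.1.2 (Ideal.mem_span_singleton_self t)
  have hb : q ≠ ⊥ := by rintro rfl; exact ht (by simpa using htq)
  refine trdeg_height_one k B q hb fun Q hQ hlt => ?_
  have h := Ideal.height_le_one_of_isPrincipal_of_mem_minimalPrimes _ q hq
  by_contra hQb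
  have hQ1 : (⊥ : Ideal B).height < Q.height := Ideal.height_strict_mono_of_isPrime (bot_lt_iff_ne_bot.2 hQb)
  have hQ2 : Q.height < q.height := Ideal.height_strict_mono_of_isPrime hlt
  have h3 : Q.height < 1 := hQ2.trans_le h
  rw [Order.lt_one_iff] at h3
  rw [h3] at hQ1
  exact not_lt_bot hQ1

theorem trdeg_step (k B : Type) [Field k] [CommRing B] [IsDomain B] [Algebra k B]
    [Algebra.FiniteType k B] (h : trdeg k B ≠ 0) :
    ∃ q : Ideal B, q.IsPrime ∧ trdeg k (B ⧸ q) + 1 = trdeg k B := by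
  have hnf : ¬ IsField B := by
    intro hf
    let := hf.toField
    have := finite_of_finite_type_of_isJacobsonRing k B
    exact h (trdeg_eq_zero)
  obtain ⟨t, ht0, htu⟩ := Ring.exists_not_isUnit_of_not_isField hnf
  have hne : Ideal.span {t} ≠ ⊤ := by rwa [Ne, Ideal.span_singleton_eq_top]
  obtain ⟨q, hq⟩ := Ideal.nonempty_minimalPrimes hne
  exact ⟨q, hq.1.1, trdeg_krull k B t ht0 q hq⟩

theorem trdeg_frac (k B C : Type) [Field k] [CommRing B] [CommRing C] [Algebra k B] [Algebra k C]
    (f : B →ₐ[k] C) (hf : ∀ c, ∃ a, IsUnit (f a) ∧ ∃ b, c * f a = f b) (Q : Ideal C) [Q.IsPrime] :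
    trdeg k (B ⧸ Q.comap f) = trdeg k (C ⧸ Q) := by
  have hle : Q.comap f ≤ Q.comap f := le_rfl
  let g : (B ⧸ Q.comap f) →ₐ[k] (C ⧸ Q) := Ideal.quotientMapₐ Q f le_rfl
  have hg : Function.Injective g := Ideal.quotientMap_injective
  algebraize [g.toRingHom]
  have hsc : IsScalarTower k (B ⧸ Q.comap f) (C ⧸ Q) := IsScalarTower.of_algHom g
  have hfs : FaithfulSMul (B ⧸ Q.comap f) (C ⧸ Q) :=
    (faithfulSMul_iff_algebraMap_injective _ _).2 hg
  have hpr : (Q.comap f).IsPrime := Ideal.IsPrime.comap f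
  have halg : Algebra.IsAlgebraic (B ⧸ Q.comap f) (C ⧸ Q) := by
    constructor
    intro c
    obtain ⟨c, rfl⟩ := Ideal.Quotient.mk_surjective c
    obtain ⟨a, ha, b, hb⟩ := hf c
    have hau : g (Ideal.Quotient.mk _ a) ≠ 0 := (ha.map (Ideal.Quotient.mk Q)).ne_zero
    have ha0 : (Ideal.Quotient.mk (Q.comap f) a) ≠ 0 := by
      intro h; rw [h, map_zero] at hau; exact hau rfl
    refine ⟨Polynomial.C (Ideal.Quotient.mk _ a) * Polynomial.X - Polynomial.C (Ideal.Quotient.mk _ b), ?_, ?_⟩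
    · intro h
      have := congrArg (fun p => Polynomial.coeff p 1) h
      simp at this
      exact ha0 (by simpa [Polynomial.coeff_C] using this)
    · simp only [map_sub, map_mul, Polynomial.aeval_C, Polynomial.aeval_X]
      have : algebraMap (B ⧸ Q.comap f) (C ⧸ Q) = g.toRingHom := rfl
      have h1 : (Ideal.Quotient.mk Q) (c * f a) = (Ideal.Quotient.mk Q) (f b) := by rw [hb]
      rw [map_mul, mul_comm] at h1
      rw [sub_eq_zero]
      exact h1
  exact trdeg_alg k _ _

theorem prime_lt (k B : Type) [Field k] [CommRing B] [Algebra k B] [Algebra.FiniteType k B]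
    (p q : Ideal B) [p.IsPrime] [q.IsPrime] (h : p < q) : trdeg k (B ⧸ q) < trdeg k (B ⧸ p) := by
  obtain ⟨b, hbq, hbp⟩ := Set.exists_of_ssubset h
  refine trdeg_lt k _ _ trdeg_lt_aleph0_of_finiteType (Ideal.Quotient.factorₐ k h.le)
    (Ideal.Quotient.factor_surjective h.le) (Ideal.Quotient.mk p b) ?_ ?_
  · rwa [Ne, Ideal.Quotient.eq_zero_iff_mem]
  · exact Ideal.Quotient.eq_zero_iff_mem.2 hbq

theorem prime_comap (k A B : Type) [Field k] [CommRing A] [Algebra k A] [CommRing B] [Algebra k B] 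
    (f : A →ₐ[k] B) (p : Ideal B) [p.IsPrime] :
    trdeg k (A ⧸ p.comap f) ≤ trdeg k (B ⧸ p) := 
  trdeg_le_of_injective (Ideal.quotientMapₐ p f le_rfl) Ideal.quotientMap_injective

theorem prime_krull (k B : Type) [Field k] [CommRing B] [Algebra k B] [Algebra.FiniteType k B]
    (p q : Ideal B) [p.IsPrime] [q.IsPrime] (h : p ≤ q) (t : B) (htp : t ∉ p) (htq : t ∈ q)
    (hmin : ∀ q' : Ideal B, q'.IsPrime → p ≤ q' → t ∈ q' → q' ≤ q → q' = q) :
    trdeg k (B ⧸ q) + 1 = trdeg k (B ⧸ p) := by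
  have hc : (q.map (Ideal.Quotient.mk p)).comap (Ideal.Quotient.mkₐ k p) = q := by
    show (q.map (Ideal.Quotient.mk p)).comap (Ideal.Quotient.mk p) = q
    rw [Ideal.comap_map_of_surjective _ Ideal.Quotient.mk_surjective]
    simpa [← RingHom.ker_eq_comap_bot] using h
  have hp : (q.map (Ideal.Quotient.mk p)).IsPrime := 
    Ideal.map_isPrime_of_surjective Ideal.Quotient.mk_surjective (by simpa using h)
  have h1 := trdeg_frac k B (B ⧸ p) (Ideal.Quotient.mkₐ k p) 
    (fun c => ⟨1, by simp, by obtain ⟨b, rfl⟩ := Ideal.Quotient.mk_surjective c; exact ⟨b, by simp⟩⟩) 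
    (q.map (Ideal.Quotient.mk p))
  rw [hc] at h1
  rw [h1]
  apply trdeg_krull k (B ⧸ p) (Ideal.Quotient.mk p t) (by rwa [Ne, Ideal.Quotient.eq_zero_iff_mem])
  refine ⟨⟨hp, ?_⟩, ?_⟩
  · rw [Ideal.span_singleton_le_iff_mem]; exact Ideal.mem_map_of_mem _ htq
  · rintro Q ⟨hQ, htQ⟩ hQq
    have hQp : (Q.comap (Ideal.Quotient.mk p)).IsPrime := Ideal.IsPrime.comap _
    have := hmin (Q.comap (Ideal.Quotient.mk p)) hQp ?_ ?_ ?_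
    · rw [← this, Ideal.map_comap_of_surjective _ Ideal.Quotient.mk_surjective]
    · intro x hx
      rw [Ideal.mem_comap, Ideal.Quotient.eq_zero_iff_mem.2 hx]; exact zero_mem _
    · exact htQ (Ideal.mem_span_singleton_self _)
    · exact (Ideal.comap_mono hQq).trans hc.le



theorem prime_step (k A B : Type) [Field k] [CommRing A] [Algebra k A] [CommRing B] [Algebra k B]
    [Algebra.FiniteType k B] [Algebra A B] [IsScalarTower k A B] (p : Ideal B) [p.IsPrime]
    (hne : trdeg k (A ⧸ p.under A) ≠ trdeg k (B ⧸ p)) :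
    ∃ q : Ideal B, q.IsPrime ∧ p ≤ q ∧ q.under A = p.under A ∧ 
      trdeg k (B ⧸ q) + 1 = trdeg k (B ⧸ p) := by
  let A0 := A ⧸ p.under A
  let D := B ⧸ p
  let F := FractionRing A0
  have hfAD : FaithfulSMul A0 D := (faithfulSMul_iff_algebraMap_injective _ _).2 Ideal.quotientMap_injective
  let M := Algebra.algebraMapSubmonoid D (nonZeroDivisors A0)
  have hM : M ≤ nonZeroDivisors D := by
    apply map_le_nonZeroDivisors_of_injective _ (FaithfulSMul.algebraMap_injective A0 D) le_rfl
  let B' := Localization M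
  have : IsDomain B' := IsLocalization.isDomain_localization hM
  let : Algebra F B' := localizationAlgebra (nonZeroDivisors A0) D
  have hsc1 : IsScalarTower A0 F B' := inferInstance
  have hsc3 : IsScalarTower k A0 B' := by
    refine IsScalarTower.of_algebraMap_eq fun x => ?_
    rw [IsScalarTower.algebraMap_apply k D B', IsScalarTower.algebraMap_apply A0 D B',
      IsScalarTower.algebraMap_apply k A0 D]
  have hsc2 : IsScalarTower k F B' := by
    refine IsScalarTower.of_algebraMap_eq fun x => ?_
    rw [IsScalarTower.algebraMap_apply k A0 B', IsScalarTower.algebraMap_apply k A0 F,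
      ← IsScalarTower.algebraMap_apply A0 F B']
  have hftD : Algebra.FiniteType A0 D := by
    have : Algebra.FiniteType k D := inferInstance
    exact Algebra.FiniteType.of_restrictScalars_finiteType k A0 D
  have hft : Algebra.FiniteType F B' := by
    have : IsLocalization (Submonoid.map (algebraMap A0 D) (nonZeroDivisors A0)) B' :=
      inferInstanceAs (IsLocalization M (Localization M))
    have := RingHom.finiteType_localizationPreserves (algebraMap A0 D) (nonZeroDivisors A0) F B'
      (RingHom.finiteType_algebraMap.2 hftD)
    exact this
  have hfFB : FaithfulSMul F B' :=
    (faithfulSMul_iff_algebraMap_injective _ _).2 (RingHom.injective _)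
  have hfr : ∀ c : B', ∃ a, IsUnit (algebraMap D B' a) ∧ ∃ b, c * algebraMap D B' a = algebraMap D B' b := by
    intro c
    obtain ⟨⟨b, a⟩, h⟩ := IsLocalization.surj M c
    exact ⟨a, IsLocalization.map_units _ a, b, h⟩
  have e1 : trdeg k A0 = trdeg k F := by
    have : Algebra.IsAlgebraic A0 F := IsLocalization.isAlgebraic F (nonZeroDivisors A0)
    exact trdeg_alg k A0 F
  have e2 : trdeg k D = trdeg k B' := by
    have : FaithfulSMul D B' := (faithfulSMul_iff_algebraMap_injective _ _).2 (IsLocalization.injective _ hM)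
    have : Algebra.IsAlgebraic D B' := IsLocalization.isAlgebraic B' M
    exact trdeg_alg k D B'
  have e3 : trdeg k F + trdeg F B' = trdeg k B' := trdeg_add_eq k F
  have hne0 : trdeg F B' ≠ 0 := by
    intro h
    rw [h, add_zero, ← e1, ← e2] at e3
    exact hne e3
  obtain ⟨Q, hQ, hQt⟩ := trdeg_step F B' hne0
  let f : B →ₐ[k] B' := (IsScalarTower.toAlgHom k D B').comp (Ideal.Quotient.mkₐ k p)
  have e4 : trdeg k (B ⧸ Q.comap f) = trdeg k (B' ⧸ Q) := by
    apply trdeg_frac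
    intro c
    obtain ⟨a, ha, b, hb⟩ := hfr c
    obtain ⟨a, rfl⟩ := Ideal.Quotient.mk_surjective a
    obtain ⟨b, rfl⟩ := Ideal.Quotient.mk_surjective b
    exact ⟨a, ha, b, hb⟩
  have hfF : FaithfulSMul F (B' ⧸ Q) := 
    (faithfulSMul_iff_algebraMap_injective _ _).2 (RingHom.injective _)
  have e5 : trdeg k F + trdeg F (B' ⧸ Q) = trdeg k (B' ⧸ Q) := trdeg_add_eq k F
  have hpq : p ≤ Q.comap f := by
    intro x hx
    have : f x = 0 := by
      show algebraMap D B' (Ideal.Quotient.mk p x) = 0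
      rw [Ideal.Quotient.eq_zero_iff_mem.2 hx, map_zero]
    rw [Ideal.mem_comap, this]; exact zero_mem _
  refine ⟨Q.comap f, Ideal.IsPrime.comap f, hpq, ?_, ?_⟩
  · apply le_antisymm
    · intro a ha
      by_contra hap
      have ha0 : (Ideal.Quotient.mk (p.under A) a) ≠ 0 := by rwa [Ne, Ideal.Quotient.eq_zero_iff_mem]
      have h1 : f (algebraMap A B a) = algebraMap F B' (algebraMap A0 F (Ideal.Quotient.mk _ a)) := by
        rw [← IsScalarTower.algebraMap_apply A0 F B', IsScalarTower.algebraMap_apply A0 D B']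
        rfl
      have h2 : f (algebraMap A B a) ∈ Q := ha
      rw [h1] at h2
      refine hQ.ne_top (Ideal.eq_top_of_isUnit_mem _ h2 ?_)
      apply IsUnit.map
      rw [isUnit_iff_ne_zero]
      intro h
      exact ha0 ((IsFractionRing.injective A0 F) (h.trans (map_zero _).symm))
    · exact Ideal.comap_mono hpq
  · rw [e4, ← e5, add_assoc, hQt, e3, ← e2]

open TopologicalSpace

theorem topDim (T : Type) [TopologicalSpace T] [QuasiSober T] [T0Space T] (f : T → ℕ)
    (hA : ∀ x y : T, x ⤳ y → x ≠ y → f y < f x)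
    (hB : ∀ x : T, 0 < f x → ∃ y, x ⤳ y ∧ f y + 1 = f x)
    (d : ℕ) (hle : ∀ x, f x ≤ d) (ξ : T) (hξ : f ξ = d) :
    topologicalKrullDim T = (d : WithBot ℕ∞) := by
  apply le_antisymm
  · refine iSup_le fun p => ?_
    let F : IrreducibleCloseds T → ℕ := fun Z => f (Z.2.genericPoint)
    have hF : StrictMono F := by
      intro Z W hZW
      have hZ : closure {Z.2.genericPoint} = (Z : Set T) := by
        exact Z.2.closure_genericPoint Z.3
      have hW : closure {W.2.genericPoint} = (W : Set T) := by
        exact W.2.closure_genericPoint W.3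
      apply hA
      · rw [specializes_iff_closure_subset, hZ, hW]; exact hZW.le
      · intro h
        have h2 : (Z : Set T) = W := by rw [← hZ, ← hW, h]
        exact hZW.ne (SetLike.coe_injective h2)
    have h := LTSeries.head_add_length_le_nat (p.map F hF)
    have h2 : (p.map F hF).last ≤ d := hle _
    have : p.length ≤ d := by
      have : (p.map F hF).length = p.length := rfl
      omega
    exact_mod_cast this
  · have key : ∀ n x, f x = n → ∃ p : LTSeries (IrreducibleCloseds T), p.length = n ∧
        p.last = ⟨closure {x}, isIrreducible_singleton.closure, isClosed_closure⟩ := by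
      intro n
      induction n with
      | zero => intro x _; exact ⟨RelSeries.singleton _ _, rfl, rfl⟩
      | succ n ih =>
        intro x hx
        obtain ⟨y, hxy, hy⟩ := hB x (by omega)
        obtain ⟨p, hp, hpl⟩ := ih y (by omega)
        refine ⟨p.snoc ⟨closure {x}, isIrreducible_singleton.closure, isClosed_closure⟩ ?_, ?_, ?_⟩
        · rw [hpl]
          change (_ : IrreducibleCloseds T) < _
          refine lt_of_le_of_ne ?_ ?_
          · exact specializes_iff_closure_subset.1 hxy
          · intro h
            have h2 : closure {y} = closure {x} := congrArg (fun Z : IrreducibleCloseds T => (Z : Set T)) h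
            have : y = x := (specializes_iff_closure_subset.2 h2.ge).antisymm (specializes_iff_closure_subset.2 h2.le) |>.eq
            subst this; omega
        · simp [hp]
        · simp
    obtain ⟨p, hp, _⟩ := key d ξ hξ
    rw [← hp]
    exact le_iSup (fun p : LTSeries (IrreducibleCloseds T) => (p.length : WithBot ℕ∞)) p

theorem comp_gen (Y : Type) [TopologicalSpace Y] [QuasiSober Y] (T : Set Y)
    (hT : T ∈ irreducibleComponents Y) : ∃ ξ ∈ T, closure {ξ} = T ∧ IsClosed T := by
  have hcl := isClosed_of_mem_irreducibleComponents T hT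
  have hirr : IsIrreducible T := hT.1
  have := hirr.closure_genericPoint hcl
  exact ⟨hirr.genericPoint, this.subset (subset_closure rfl), this, hcl⟩

theorem gen_comp (Y : Type) [TopologicalSpace Y] [QuasiSober Y] (ξ : Y)
    (h : ∀ z : Y, z ⤳ ξ → z = ξ) : closure {ξ} ∈ irreducibleComponents Y := by
  refine ⟨isIrreducible_singleton.closure, fun W hW hle => ?_⟩
  have hg := hW.closure.closure_genericPoint isClosed_closure
  have h1 : ξ ∈ closure {hW.closure.genericPoint} := by
    rw [hg]; exact subset_closure (hle (subset_closure rfl))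
  have h2 := h _ (specializes_iff_mem_closure.2 h1)
  rw [h2] at hg
  change W ⊆ closure {ξ}
  rw [hg]; exact subset_closure

theorem dimT {X S : Type} [TopologicalSpace X] [T0Space X]
    (φ : X → S) (tr : X → ℕ) (trS : S → ℕ)
    (hA : ∀ x y : X, x ⤳ y → x ≠ y → tr y < tr x)
    (hA0 : ∀ x, trS (φ x) ≤ tr x)
    (hB : ∀ x, trS (φ x) < tr x → ∃ y, x ⤳ y ∧ φ y = φ x ∧ tr y + 1 = tr x)
    (s : S) (Z : Set X) (hZ : ∀ x ∈ Z, φ x = s)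
    (hZcl : ∀ x ∈ Z, ∀ y, x ⤳ y → φ y = s → y ∈ Z) [QuasiSober Z]
    (T : Set Z) (hT : IsClosed T) (d : ℕ) (hd : ∀ x ∈ T, tr x.1 ≤ trS s + d)
    (ξ : Z) (hξT : ξ ∈ T) (hξ : tr ξ.1 = trS s + d) :
    topologicalKrullDim T = (d : WithBot ℕ∞) := by
  have : QuasiSober T := hT.isClosedEmbedding_subtypeVal.quasiSober
  have hsp : ∀ x y : T, x ⤳ y ↔ x.1.1 ⤳ y.1.1 := fun x y => by
    rw [← Topology.IsInducing.subtypeVal.specializes_iff, ← Topology.IsInducing.subtypeVal.specializes_iff]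
  refine topDim T (fun z => tr z.1.1 - trS s) ?_ ?_ d ?_ ⟨ξ, hξT⟩ ?_
  · intro x y hxy hne
    have h1 := hA x.1.1 y.1.1 ((hsp _ _).1 hxy) (fun h => hne (Subtype.ext (Subtype.ext h)))
    have h2 := hA0 y.1.1
    rw [hZ _ y.1.2] at h2
    omega
  · intro x hx
    obtain ⟨y, hxy, hy, hty⟩ := hB x.1.1 (by rw [hZ _ x.1.2]; omega)
    have hyZ : y ∈ Z := hZcl _ x.1.2 y hxy (by rw [hy, hZ _ x.1.2])
    have hyT : (⟨y, hyZ⟩ : Z) ∈ T := by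
      apply Specializes.mem_closed (x := x.1) _ hT x.2
      rwa [← Topology.IsInducing.subtypeVal.specializes_iff]
    refine ⟨⟨⟨y, hyZ⟩, hyT⟩, (hsp _ _).2 hxy, ?_⟩
    have h2 := hA0 y
    rw [hy, hZ _ x.1.2] at h2
    change tr y - trS s + 1 = tr x.1.1 - trS s
    omega
  · intro x
    have := hd x.1 x.2
    omega
  · change tr ξ.1 - trS s = d; omega

theorem abstract_main {X S : Type} [TopologicalSpace X] [T0Space X] [QuasiSober X] [NoetherianSpace X]
    [TopologicalSpace S] [T0Space S]
    (φ : X → S) (hφ : Continuous φ) (hqs : ∀ s, QuasiSober (φ ⁻¹' {s})) (tr : X → ℕ) (trS : S → ℕ)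
    (hA : ∀ x y : X, x ⤳ y → x ≠ y → tr y < tr x)
    (hA0 : ∀ x, trS (φ x) ≤ tr x)
    (hB : ∀ x, trS (φ x) < tr x → ∃ y, x ⤳ y ∧ φ y = φ x ∧ tr y + 1 = tr x)
    (η : S) (hη : ∀ s, η ⤳ s) (hS1 : trS η = 1) (hS0 : ∀ s, s ≠ η → trS s = 0)
    (hC : ∀ x y, φ x = η → φ y ≠ η → x ⤳ y → (∀ z, x ⤳ z → z ⤳ y → φ z = φ y → z = y) →
      tr y + 1 = tr x)
    (hsurj : Function.Surjective φ)
    (hdom : ∀ T ∈ irreducibleComponents X, Dense (φ '' T))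
    (d : WithBot ℕ∞) (hpure : ∀ T ∈ irreducibleComponents (φ ⁻¹' {η}), topologicalKrullDim T = d)
    (D : Set X) (hD : IsClosed D)
    (hgen : ∀ T ∈ irreducibleComponents ↥(D ∩ φ ⁻¹' {η}),
      topologicalKrullDim T + 1 = topologicalKrullDim (φ ⁻¹' {η}))
    (hclos : D = closure (D ∩ φ ⁻¹' {η})) (s : S) :
    ∀ T ∈ irreducibleComponents ↥(D ∩ φ ⁻¹' {s}),
      topologicalKrullDim T + 1 = topologicalKrullDim (φ ⁻¹' {s}) := by
  by_cases hs : s = η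
  · subst hs; exact hgen
  have hqsD : ∀ s, QuasiSober ↥(D ∩ φ ⁻¹' {s}) := by
    intro s
    have := hqs s
    have hemb : Topology.IsClosedEmbedding (Set.inclusion (Set.inter_subset_right : D ∩ φ ⁻¹' {s} ⊆ φ ⁻¹' {s})) := by
      refine ⟨Topology.IsEmbedding.inclusion _, ?_⟩
      rw [Set.range_inclusion]
      convert hD.preimage (continuous_subtype_val (p := fun x => x ∈ φ ⁻¹' {s})) using 1
      ext x
      exact ⟨fun h => h.1, fun h => ⟨h, x.2⟩⟩
    exact hemb.quasiSober
  have hgenη : ∀ x, x ⤳ x → ∀ y, x ⤳ y → φ y = η → φ x = η := by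
    intro x _ y hxy hy
    have h1 := hxy.map hφ
    rw [hy] at h1
    exact (h1.antisymm (hη _)).eq
  -- generic points of components of X
  have hζ : ∀ x, ∃ ζ, ζ ⤳ x ∧ φ ζ = η ∧ ∀ z, z ⤳ ζ → z = ζ := by
    intro x
    obtain ⟨ζ, hζT, hζc, hTc⟩ := comp_gen X (irreducibleComponent x) (irreducibleComponent_mem_irreducibleComponents x)
    refine ⟨ζ, ?_, ?_, ?_⟩
    · rw [specializes_iff_mem_closure, hζc]; exact mem_irreducibleComponent
    · have h1 := hdom _ (irreducibleComponent_mem_irreducibleComponents x)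
      have h2 : φ '' (irreducibleComponent x) ⊆ closure {φ ζ} := by
        rintro _ ⟨z, hz, rfl⟩
        rw [← hζc, ← specializes_iff_mem_closure] at hz
        exact specializes_iff_mem_closure.1 (hz.map hφ)
      have h3 : η ∈ closure {φ ζ} := by
        have := closure_minimal h2 isClosed_closure
        rw [h1.closure_eq] at this
        exact this trivial
      exact ((specializes_iff_mem_closure.2 h3).antisymm (hη _)).eq
    · intro z hz
      have h1 := (irreducibleComponent_mem_irreducibleComponents x).2 (isIrreducible_singleton (x := z)).closure
        (by change irreducibleComponent x ⊆ closure {z}; rw [← hζc]; exact specializes_iff_closure_subset.1 hz)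
      have h2 : ζ ⤳ z := by
        rw [specializes_iff_mem_closure, hζc]; exact h1 (subset_closure rfl)
      exact (hz.antisymm h2).eq
  -- components of generic fibre
  have hcompη : ∀ ζ, φ ζ = η → (∀ z, z ⤳ ζ → z = ζ) → d = ((tr ζ - 1 : ℕ) : WithBot ℕ∞) ∧ 1 ≤ tr ζ := by
    intro ζ h1 h2
    have := hqs η
    have h3 := hA0 ζ
    rw [h1, hS1] at h3
    refine ⟨?_, h3⟩
    let ζ' : φ ⁻¹' {η} := ⟨ζ, h1⟩
    have hc := gen_comp (φ ⁻¹' {η}) ζ' (fun z hz => Subtype.ext (h2 z.1 (hz.map continuous_subtype_val)))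
    rw [← hpure _ hc]
    refine dimT φ tr trS hA hA0 hB η (φ ⁻¹' {η}) (fun x hx => hx) (fun x hx y hxy hy => hy) _ isClosed_closure _ ?_ ζ' (subset_closure rfl) ?_
    · intro x hx
      by_cases hxe : ζ = x.1
      · rw [← hxe]; omega
      · have := hA ζ x.1 ((specializes_iff_mem_closure.2 hx).map continuous_subtype_val) hxe
        omega
    · show tr ζ = _
      omega
  obtain ⟨x0, hx0⟩ := hsurj η
  obtain ⟨ζ0, hζ0x, hζ0η, hζ0m⟩ := hζ x0
  obtain ⟨hd0, hd1⟩ := hcompη ζ0 hζ0η hζ0m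
  obtain ⟨e, he⟩ : ∃ e, tr ζ0 = 1 + e := ⟨tr ζ0 - 1, by omega⟩
  have hmax : ∀ ζ, φ ζ = η → (∀ z, z ⤳ ζ → z = ζ) → tr ζ = 1 + e := by
    intro ζ h1 h2
    obtain ⟨h3, h4⟩ := hcompη ζ h1 h2
    rw [hd0] at h3
    have : tr ζ0 - 1 = tr ζ - 1 := by exact_mod_cast h3
    omega
  have hmono : ∀ x y, x ⤳ y → tr y ≤ tr x := by
    intro x y h
    by_cases hxy : x = y
    · rw [hxy]
    · exact (hA x y h hxy).le
  have htruniv : ∀ (s : S) (e : ℕ), (∀ x, φ x = s → tr x ≤ trS s + e) → (∃ x, φ x = s ∧ tr x = trS s + e) →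
      topologicalKrullDim (φ ⁻¹' {s}) = (e : WithBot ℕ∞) := by
    rintro s e h1 ⟨x, hx, hxt⟩
    have := hqs s
    rw [← dimT φ tr trS hA hA0 hB s (φ ⁻¹' {s}) (fun x hx => hx) (fun x hx y hxy hy => hy) Set.univ isClosed_univ e
      (fun x _ => h1 x.1 x.2) ⟨x, hx⟩ trivial hxt]
    exact ((Homeomorph.Set.univ _).isHomeomorph.topologicalKrullDim_eq).symm
  have hdimη : topologicalKrullDim (φ ⁻¹' {η}) = (e : WithBot ℕ∞) := by
    refine htruniv η e ?_ ⟨ζ0, hζ0η, by omega⟩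
    intro x hx
    obtain ⟨ζ, h1, h2, h3⟩ := hζ x
    rw [hS1, ← hmax ζ h2 h3]; exact hmono _ _ h1
  have hdims : topologicalKrullDim (φ ⁻¹' {s}) = (e : WithBot ℕ∞) := by
    have key : ∀ x, φ x = s → ∃ y, φ y = s ∧ y ⤳ x ∧ tr y = e := by
      intro x hx
      obtain ⟨ζ, h1, h2, h3⟩ := hζ x
      let P : ℕ → Prop := fun n => ∃ y, ζ ⤳ y ∧ y ⤳ x ∧ φ y = s ∧ tr y = n
      have hP : ∃ n, P n := ⟨tr x, x, h1, specializes_rfl, hx, rfl⟩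
      classical
      obtain ⟨y, hy1, hy2, hy3, hy4⟩ : P (Nat.findGreatest P (tr ζ)) :=
        Nat.findGreatest_spec (m := tr x) (hmono _ _ h1) ⟨x, h1, specializes_rfl, hx, rfl⟩
      refine ⟨y, hy3, hy2, ?_⟩
      have := hC ζ y h2 (by rw [hy3]; exact hs) hy1 ?_
      · have := hmax ζ h2 h3
        omega
      · intro z hz1 hz2 hz3
        by_contra hne
        have h5 := hA z y hz2 hne
        have h6 : tr z ≤ Nat.findGreatest P (tr ζ) :=
          Nat.le_findGreatest (hmono _ _ hz1) ⟨z, hz1, hz2.trans hy2, hz3.trans hy3, rfl⟩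
        omega
    refine htruniv s e ?_ ?_
    · intro x hx
      obtain ⟨y, hy1, hy2, hy3⟩ := key x hx
      have := hmono _ _ hy2
      omega
    · obtain ⟨x, hx⟩ := hsurj s
      obtain ⟨y, hy1, hy2, hy3⟩ := key x hx
      exact ⟨y, hy1, by rw [hS0 s hs]; omega⟩
  intro T hT
  have := hqsD s
  obtain ⟨y, hyT, hyc, hTc⟩ := comp_gen _ T hT
  have hdimT : topologicalKrullDim T = (tr y.1 : WithBot ℕ∞) := by
    refine dimT φ tr trS hA hA0 hB s (D ∩ φ ⁻¹' {s}) (fun x hx => hx.2)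
      (fun x hx y hxy hy => ⟨hxy.mem_closed hD hx.1, hy⟩) T hTc _ ?_ y hyT ?_
    · intro x hx
      rw [← hyc, ← specializes_iff_mem_closure] at hx
      have := hmono _ _ (hx.map continuous_subtype_val)
      omega
    · rw [hS0 s hs]; omega
  -- ξ
  have hξ : ∃ ξ : ↥(D ∩ φ ⁻¹' {η}), ξ.1 ⤳ y.1 ∧ closure {ξ} ∈ irreducibleComponents ↥(D ∩ φ ⁻¹' {η}) := by
    have := hqsD η
    have hns : NoetherianSpace ↥(D ∩ φ ⁻¹' {η}) := inferInstance
    have hfin := NoetherianSpace.finite_irreducibleComponents (α := ↥(D ∩ φ ⁻¹' {η}))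
    have hcov : (D ∩ φ ⁻¹' {η}) = ⋃ T ∈ irreducibleComponents ↥(D ∩ φ ⁻¹' {η}), Subtype.val '' T := by
      ext x
      simp only [Set.mem_iUnion]
      constructor
      · intro hx
        exact ⟨irreducibleComponent ⟨x, hx⟩, irreducibleComponent_mem_irreducibleComponents _, ⟨x, hx⟩, mem_irreducibleComponent, rfl⟩
      · rintro ⟨T, hT, z, hz, rfl⟩; exact z.2
    have hyD : y.1 ∈ closure (D ∩ φ ⁻¹' {η}) := hclos ▸ y.2.1
    rw [hcov, hfin.closure_biUnion] at hyD
    simp only [Set.mem_iUnion] at hyD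
    obtain ⟨W, hW, hyW⟩ := hyD
    obtain ⟨ξ, hξW, hξc, hWc⟩ := comp_gen _ W hW
    refine ⟨ξ, ?_, hξc ▸ hW⟩
    rw [specializes_iff_mem_closure]
    refine closure_minimal ?_ isClosed_closure hyW
    rintro _ ⟨z, hz, rfl⟩
    rw [← hξc, ← specializes_iff_mem_closure] at hz
    exact specializes_iff_mem_closure.1 (hz.map continuous_subtype_val)
  obtain ⟨ξ, hξy, hξc⟩ := hξ
  have := hqsD η
  have h3 := hA0 ξ.1
  rw [show φ ξ.1 = η from ξ.2.2, hS1] at h3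
  have hdimξ : topologicalKrullDim (closure {ξ}) = ((tr ξ.1 - 1 : ℕ) : WithBot ℕ∞) := by
    refine dimT φ tr trS hA hA0 hB η (D ∩ φ ⁻¹' {η}) (fun x hx => hx.2)
      (fun x hx y hxy hy => ⟨hxy.mem_closed hD hx.1, hy⟩) _ isClosed_closure _ ?_ ξ (subset_closure rfl) ?_
    · intro x hx
      rw [← specializes_iff_mem_closure] at hx
      have := hmono _ _ (hx.map continuous_subtype_val)
      omega
    · omega
  have h4 := hgen _ hξc
  rw [hdimξ, hdimη] at h4
  have h5 : tr ξ.1 - 1 + 1 = e := by exact_mod_cast h4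
  have h6 := hC ξ.1 y.1 ξ.2.2 (by rw [show φ y.1 = s from y.2.2]; exact hs) hξy ?_
  · rw [hdimT, hdims]
    have : tr y.1 + 1 = e := by omega
    exact_mod_cast this
  · intro z hz1 hz2 hz3
    have hzZ : z ∈ D ∩ φ ⁻¹' {s} := ⟨hz1.mem_closed hD ξ.2.1, hz3.trans y.2.2⟩
    have h7 : (⟨z, hzZ⟩ : ↥(D ∩ φ ⁻¹' {s})) ⤳ y := by
      rwa [← Topology.IsInducing.subtypeVal.specializes_iff]
    have h8 : closure {(⟨z, hzZ⟩ : ↥(D ∩ φ ⁻¹' {s}))} ⊆ T := 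
      hT.2 isIrreducible_singleton.closure (by 
        change T ⊆ _; rw [← hyc]; exact specializes_iff_closure_subset.1 h7)
    have h9 : y ⤳ ⟨z, hzZ⟩ := by
      rw [specializes_iff_mem_closure, hyc]; exact h8 (subset_closure rfl)
    exact (hz2.antisymm (h9.map continuous_subtype_val)).eq

open AlgebraicGeometry CategoryTheory CategoryTheory.Limits TopologicalSpace

noncomputable def trL (K : Type) [Field K] (L : CommRingCat.{0}) (g : Spec L ⟶ Spec (CommRingCat.of K)) : ℕ :=
  Cardinal.toNat (@Algebra.trdeg K L _ _ (Spec.preimage g).hom.toAlgebra)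

theorem trL_map (K : Type) [Field K] (L : CommRingCat.{0}) (h : CommRingCat.of K ⟶ L) :
    trL K L (Spec.map h) = Cardinal.toNat (@Algebra.trdeg K L _ _ h.hom.toAlgebra) := by
  unfold trL; rw [Spec.preimage_map]

theorem trL_iso (K : Type) [Field K] (L L' : CommRingCat.{0}) (e : L ≅ L') (g : Spec L ⟶ Spec (CommRingCat.of K)) :
    trL K L' (Spec.map e.hom ≫ g) = trL K L g := by
  obtain ⟨h, rfl⟩ := Spec.map_surjective g
  rw [← Spec.map_comp, trL_map, trL_map]
  letI := h.hom.toAlgebra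
  letI := (h ≫ e.hom).hom.toAlgebra
  have E : L ≃ₐ[K] L' := AlgEquiv.ofRingEquiv (f := e.commRingCatIsoToRingEquiv) (fun r => rfl)
  exact congrArg _ E.trdeg_eq.symm

noncomputable def trp (K : Type) [Field K] {X : Scheme.{0}} (f : X ⟶ Spec (CommRingCat.of K)) (x : X) : ℕ :=
  trL K (X.residueField x) (X.fromSpecResidueField x ≫ f)

theorem trp_open (K : Type) [Field K] {X Y : Scheme.{0}} (j : Y ⟶ X) [IsOpenImmersion j]
    (f : X ⟶ Spec (CommRingCat.of K)) (y : Y) : trp K f (j y) = trp K (j ≫ f) y := by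
  unfold trp
  rw [← trL_iso K _ _ (asIso (j.residueFieldMap y))]
  simp

theorem trp_spec (K : Type) [Field K] (B : Type) [CommRing B] [Algebra K B] (p : PrimeSpectrum B) :
    trp K (Spec.map (CommRingCat.ofHom (algebraMap K B))) (show Spec (CommRingCat.of B) from p) =
      Cardinal.toNat (trdeg K (B ⧸ p.asIdeal)) := by
  unfold trp
  rw [← Scheme.Spec.map_residueFieldIso_inv_eq_fromSpecResidueField, Category.assoc,
    ← Iso.symm_hom, trL_iso, ← Spec.map_comp, trL_map]
  have h := trdeg_frac K B p.asIdeal.ResidueField (IsScalarTower.toAlgHom K B _) ?_ ⊥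
  · have h2 : (⊥ : Ideal p.asIdeal.ResidueField).comap (IsScalarTower.toAlgHom K B p.asIdeal.ResidueField) = p.asIdeal := by
      ext b
      simp
    rw [h2] at h
    rw [h]
    have e1 : trdeg K (p.asIdeal.ResidueField ⧸ (⊥ : Ideal p.asIdeal.ResidueField)) =
        trdeg K p.asIdeal.ResidueField := (AlgEquiv.quotientBot K p.asIdeal.ResidueField).trdeg_eq
    rw [e1]
    have e2 : (CommRingCat.ofHom (algebraMap K B) ≫
      CommRingCat.ofHom (algebraMap B p.asIdeal.ResidueField)).hom.toAlgebra =
        (inferInstance : Algebra K p.asIdeal.ResidueField) := by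
      apply Algebra.algebra_ext
      intro r
      exact (IsScalarTower.algebraMap_apply K B p.asIdeal.ResidueField r).symm
    exact congrArg (fun i : Algebra K p.asIdeal.ResidueField => Cardinal.toNat (@Algebra.trdeg K p.asIdeal.ResidueField _ _ i)) e2
  · intro c
    obtain ⟨a, b, hb, rfl⟩ := IsFractionRing.div_surjective (A := B ⧸ p.asIdeal) c
    obtain ⟨a, rfl⟩ := Ideal.Quotient.mk_surjective a
    obtain ⟨b, rfl⟩ := Ideal.Quotient.mk_surjective b
    have hb0 : algebraMap (B ⧸ p.asIdeal) p.asIdeal.ResidueField (Ideal.Quotient.mk _ b) ≠ 0 :=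
      IsFractionRing.to_map_ne_zero_of_mem_nonZeroDivisors hb
    refine ⟨b, ?_, a, ?_⟩
    · exact isUnit_iff_ne_zero.2 hb0
    · exact div_mul_cancel₀ _ hb0

theorem chartK (K : Type) [Field K] {X S : Scheme.{0}} (f : X ⟶ Spec (CommRingCat.of K))
    (g : S ⟶ Spec (CommRingCat.of K)) [LocallyOfFiniteType f] [LocallyOfFiniteType g] (φ : X ⟶ S)
    (hφ : φ ≫ g = f) (y : X) : ∃ (A B : Type) (_ : CommRing A) (_ : CommRing B) (_ : Algebra K A)
      (_ : Algebra K B) (_ : Algebra A B) (_ : IsScalarTower K A B) (_ : Algebra.FiniteType K A)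
      (_ : Algebra.FiniteType K B) (i : PrimeSpectrum A → S) (j : PrimeSpectrum B → X),
      Topology.IsOpenEmbedding i ∧ Topology.IsOpenEmbedding j ∧ y ∈ Set.range j ∧
      (∀ p, φ (j p) = i (PrimeSpectrum.comap (algebraMap A B) p)) ∧
      (∀ p, trp K g (i p) = Cardinal.toNat (trdeg K (A ⧸ p.asIdeal))) ∧
      (∀ p, trp K f (j p) = Cardinal.toNat (trdeg K (B ⧸ p.asIdeal))) := by
  obtain ⟨V, hV, hyV, -⟩ := exists_isAffineOpen_mem_and_subset (X := S) (x := φ y) (U := ⊤) trivial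
  obtain ⟨W, hW, hyW, hWV⟩ := exists_isAffineOpen_mem_and_subset (X := X) (x := y) (U := φ ⁻¹ᵁ V) hyV
  obtain ⟨a, ha⟩ := Spec.map_surjective (hV.fromSpec ≫ g)
  obtain ⟨b, hb⟩ := Spec.map_surjective (hW.fromSpec ≫ f)
  have hsq := IsAffineOpen.SpecMap_appLE_fromSpec φ hV hW hWV
  have hab : b = a ≫ φ.appLE V W hWV := by
    apply Spec.map_injective
    rw [Spec.map_comp, ha, hb, reassoc_of% hsq, hφ]
  have fa : a.hom.FiniteType := by
    rw [← HasRingHomProperty.Spec_iff (P := @LocallyOfFiniteType), ha]; infer_instance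
  have fb : b.hom.FiniteType := by
    rw [← HasRingHomProperty.Spec_iff (P := @LocallyOfFiniteType), hb]; infer_instance
  let ia : Algebra K Γ(S, V) := a.hom.toAlgebra
  let ib : Algebra K Γ(X, W) := b.hom.toAlgebra
  let iab : Algebra Γ(S, V) Γ(X, W) := (φ.appLE V W hWV).hom.toAlgebra
  have ist : IsScalarTower K Γ(S, V) Γ(X, W) := IsScalarTower.of_algebraMap_eq' (by
    change b.hom = (φ.appLE V W hWV).hom.comp a.hom
    rw [hab]; rfl)
  refine ⟨Γ(S, V), Γ(X, W), inferInstance, inferInstance, ia, ib, iab, ist, fa, fb,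
    hV.fromSpec, hW.fromSpec, hV.fromSpec.isOpenEmbedding, hW.fromSpec.isOpenEmbedding, ?_, ?_, ?_, ?_⟩
  · exact hW.range_fromSpec.ge hyW
  · intro p
    have := congrArg (fun h : Spec Γ(X, W) ⟶ S => h p) hsq
    exact this.symm
  · intro p
    refine (trp_open K hV.fromSpec g p).trans ?_
    rw [← ha]
    exact trp_spec K Γ(S, V) p
  · intro p
    refine (trp_open K hW.fromSpec f p).trans ?_
    rw [← hb]
    exact trp_spec K Γ(X, W) p

theorem factA (K : Type) [Field K] {X : Scheme.{0}} (f : X ⟶ Spec (CommRingCat.of K))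
    [LocallyOfFiniteType f] (x y : X) (h : x ⤳ y) (hne : x ≠ y) : trp K f y < trp K f x := by
  obtain ⟨A, B, _, _, _, _, _, _, _, _, i, j, hi, hj, ⟨q, rfl⟩, -, -, hB⟩ := chartK K f f (𝟙 X) (by simp) y
  obtain ⟨p, rfl⟩ := h.mem_open hj.isOpen_range ⟨q, rfl⟩
  rw [hB, hB]
  have h1 := hj.isInducing.specializes_iff.1 h
  have h2 : p < q := lt_of_le_of_ne ((PrimeSpectrum.le_iff_specializes _ _).2 h1) (fun h => hne (by rw [h]))
  exact Cardinal.toNat_lt_toNat (prime_lt K B p.asIdeal q.asIdeal h2) trdeg_lt_aleph0_of_finiteType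

theorem factA0 (K : Type) [Field K] {X S : Scheme.{0}} (f : X ⟶ Spec (CommRingCat.of K))
    (g : S ⟶ Spec (CommRingCat.of K)) [LocallyOfFiniteType f] [LocallyOfFiniteType g] (φ : X ⟶ S)
    (hφ : φ ≫ g = f) (x : X) : trp K g (φ x) ≤ trp K f x := by
  obtain ⟨A, B, _, _, _, _, _, _, _, _, i, j, hi, hj, ⟨q, rfl⟩, hc, hA, hB⟩ := chartK K f g φ hφ x
  rw [hc, hA, hB]
  exact Cardinal.toNat_le_toNat (prime_comap K A B (IsScalarTower.toAlgHom K A B) q.asIdeal) trdeg_lt_aleph0_of_finiteType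

theorem factB (K : Type) [Field K] {X S : Scheme.{0}} (f : X ⟶ Spec (CommRingCat.of K))
    (g : S ⟶ Spec (CommRingCat.of K)) [LocallyOfFiniteType f] [LocallyOfFiniteType g] (φ : X ⟶ S)
    (hφ : φ ≫ g = f) (x : X) (hx : trp K g (φ x) < trp K f x) :
    ∃ y, x ⤳ y ∧ φ y = φ x ∧ trp K f y + 1 = trp K f x := by
  obtain ⟨A, B, _, _, _, _, _, _, _, _, i, j, hi, hj, ⟨p, rfl⟩, hc, hA, hB⟩ := chartK K f g φ hφ x
  rw [hc, hA, hB] at hx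
  obtain ⟨q, hq, hpq, hqA, ht⟩ := prime_step K A B p.asIdeal (fun h => by
    have := congrArg Cardinal.toNat h
    exact hx.ne this)
  refine ⟨j ⟨q, hq⟩, hj.isInducing.specializes_iff.2 ((PrimeSpectrum.le_iff_specializes _ _).1 hpq), ?_, ?_⟩
  · rw [hc, hc]
    exact congrArg i (PrimeSpectrum.ext hqA)
  · rw [hB, hB, ← ht, Cardinal.toNat_add trdeg_lt_aleph0_of_finiteType one_lt_aleph0]
    simp

theorem factC (K : Type) [Field K] {X S : Scheme.{0}} (f : X ⟶ Spec (CommRingCat.of K))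
    (g : S ⟶ Spec (CommRingCat.of K)) [LocallyOfFiniteType f] [LocallyOfFiniteType g] (φ : X ⟶ S)
    (hφ : φ ≫ g = f) (η : S) (hη : ∀ s, η ⤳ s) (hS0 : ∀ s, s ≠ η → trp K g s = 0)
    (x y : X) (hx : φ x = η) (hy : φ y ≠ η) (hxy : x ⤳ y)
    (hmin : ∀ z, x ⤳ z → z ⤳ y → φ z = φ y → z = y) : trp K f y + 1 = trp K f x := by
  obtain ⟨A, B, _, _, _, _, _, _, _, _, i, j, hi, hj, ⟨q, rfl⟩, hc, hA, hB⟩ := chartK K f g φ hφ y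
  obtain ⟨p, rfl⟩ := hxy.mem_open hj.isOpen_range ⟨q, rfl⟩
  have hpq : p ≤ q := (PrimeSpectrum.le_iff_specializes _ _).2 (hj.isInducing.specializes_iff.1 hxy)
  have hle : PrimeSpectrum.comap (algebraMap A B) p ≤ PrimeSpectrum.comap (algebraMap A B) q :=
    Ideal.comap_mono hpq
  have hlt : PrimeSpectrum.comap (algebraMap A B) p < PrimeSpectrum.comap (algebraMap A B) q :=
    lt_of_le_of_ne hle (fun h => hy (by rw [← hx, hc, hc, h]))
  obtain ⟨t, htq, htp⟩ := Set.exists_of_ssubset (show (PrimeSpectrum.comap (algebraMap A B) p).asIdeal < (PrimeSpectrum.comap (algebraMap A B) q).asIdeal from hlt)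
  have key := prime_krull K B p.asIdeal q.asIdeal hpq (algebraMap A B t) htp htq ?_
  · rw [hB, hB, ← key, Cardinal.toNat_add trdeg_lt_aleph0_of_finiteType one_lt_aleph0]
    simp
  · intro q' hq' h1 h2 h3
    have hz : j ⟨q', hq'⟩ = j q := by
      refine hmin _ (hj.isInducing.specializes_iff.2 ((PrimeSpectrum.le_iff_specializes _ _).1 h1))
        (hj.isInducing.specializes_iff.2 ((PrimeSpectrum.le_iff_specializes _ _).1 h3)) ?_
      by_contra hne
      have h4 : φ (j ⟨q', hq'⟩) ⤳ φ (j q) := by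
        rw [hc, hc]
        exact hi.isInducing.specializes_iff.2 ((PrimeSpectrum.le_iff_specializes _ _).1 (Ideal.comap_mono h3))
      have h5 := factA K g _ _ h4 hne
      have h6 := hS0 (φ (j ⟨q', hq'⟩)) (by
        rw [← hx, hc, hc]
        intro h
        have := hi.injective h
        apply htp
        have h7 : t ∈ (PrimeSpectrum.comap (algebraMap A B) ⟨q', hq'⟩).asIdeal := h2
        rw [this] at h7
        exact h7)
      omega
    exact congrArg PrimeSpectrum.asIdeal (hj.injective hz)

theorem factS (K : Type) [Field K] {S : Scheme.{0}} 
    (g : S ⟶ Spec (CommRingCat.of K)) [LocallyOfFiniteType g] (η : S) (hη : ∀ s, η ⤳ s)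
    (hdim : topologicalKrullDim S = 1) : trp K g η = 1 := by
  have h0 : ∀ s, trp K (𝟙 (Spec (CommRingCat.of K))) s = 0 := by
    intro s
    have h1 := trp_spec K K s
    have h2 : Spec.map (CommRingCat.ofHom (algebraMap K K)) = 𝟙 (Spec (CommRingCat.of K)) := Spec.map_id _
    rw [h2] at h1
    rw [← Nat.le_zero]
    refine h1.le.trans ?_
    have h3 : trdeg K (K ⧸ s.asIdeal) = 0 := trdeg_eq_zero
    simp [h3]
  have h1 := topDim S (trp K g) (factA K g) (fun x hx => by
    obtain ⟨y, h1, -, h2⟩ := factB K g (𝟙 _) g (Category.comp_id _) x (by rw [h0]; exact hx)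
    exact ⟨y, h1, h2⟩) (trp K g η) (fun x => by
      by_cases h : η = x
      · rw [h]
      · exact (factA K g _ _ (hη x) h).le) η rfl
  rw [hdim] at h1
  exact_mod_cast h1.symm

theorem qsFib {X S : Scheme.{0}} (φ : X ⟶ S) (s : S) : QuasiSober (φ ⁻¹' {s}) :=
  (φ.fiberHomeo s).symm.isClosedEmbedding.quasiSober

theorem noethX (K : Type) [Field K] {X : Scheme.{0}} (f : X ⟶ Spec (CommRingCat.of K))
    [LocallyOfFiniteType f] [QuasiCompact f] : NoetherianSpace X := by
  have : IsLocallyNoetherian X := LocallyOfFiniteType.isLocallyNoetherian f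
  have : CompactSpace X := QuasiCompact.compactSpace_of_compactSpace f
  have : IsNoetherian X := {}
  infer_instance

end Helpers

open AlgebraicGeometry CategoryTheory CategoryTheory.Limits TopologicalSpace

noncomputable section

namespace HLpaper

attribute [local instance] MvPolynomial.gradedAlgebra

/-- The spectrum of a commutative ring as a scheme. -/
abbrev SpecOf (K : Type) [CommRing K] : Scheme := Spec (CommRingCat.of K)

/-- Projective `n`-space over `K`, as `Proj` of the polynomial ring in `n+1` variables. -/
abbrev ProjSpace (K : Type) [CommRing K] (n : ℕ) : Scheme :=
  Proj (MvPolynomial.homogeneousSubmodule (Fin (n + 1)) K)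

/-- The structure morphism of projective space over `K`. -/
def ProjSpace.structMap (K : Type) [CommRing K] (n : ℕ) :
    ProjSpace K n ⟶ SpecOf K :=
  Proj.toSpecZero _ ≫ Spec.map (CommRingCat.ofHom
    (algebraMap K ↥(MvPolynomial.homogeneousSubmodule (Fin (n + 1)) K 0)))

/-- A `K`-variety: a reduced scheme, separated and of finite type over `Spec K`. -/
structure Variety (K : Type) [Field K] where
  X : Scheme
  structMap : X ⟶ SpecOf K
  reduced : IsReduced X
  separated : IsSeparated structMap
  locallyOfFiniteType : LocallyOfFiniteType structMap
  quasiCompact : QuasiCompact structMap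

variable {K : Type} [Field K]

/-- The dimension of a variety, as the Krull dimension of its underlying space. -/
def Variety.dim (V : Variety K) : WithBot ℕ∞ := topologicalKrullDim V.X

/-- A topological space is pure of dimension `d` if all its irreducible components
have dimension `d`. -/
def IsPureOfDim (α : Type*) [TopologicalSpace α] (d : WithBot ℕ∞) : Prop :=
  ∀ T ∈ irreducibleComponents α, topologicalKrullDim T = d

/-- A topological space is pure if all its irreducible components have the same dimension. -/
def IsPure (α : Type*) [TopologicalSpace α] : Prop := ∃ d, IsPureOfDim α d

/-- The (topological) fibre of a morphism of schemes over a point of the target. -/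
def fiber {X Y : Scheme} (f : X ⟶ Y) (y : Y) : Set X := f.base ⁻¹' {y}

/-- A variety is quasi-projective if it admits a locally closed immersion
into some projective space over `K`. -/
def Variety.IsQuasiProjective (V : Variety K) : Prop :=
  ∃ (n : ℕ) (i : V.X ⟶ ProjSpace K n),
    IsImmersion i ∧ i ≫ ProjSpace.structMap K n = V.structMap

/-- "Every irreducible component of `D ∩ X_s` has codimension `1` in the fibre `X_s`":
the dimension of each component of `D ∩ X_s`, plus one, is the dimension of `X_s`. -/
def FibrewiseCodimOne {X Y : Scheme} (φ : X ⟶ Y) (D : Set X) (s : Y) : Prop :=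
  ∀ T ∈ irreducibleComponents ↥(D ∩ fiber φ s),
    topologicalKrullDim T + 1 = topologicalKrullDim (fiber φ s)

/-- Over a smooth connected curve, a closed subset which is the closure of its
generic fibre and is generically of fibrewise codimension one is of fibrewise codimension one
everywhere. -/
theorem statement6 (K : Type) [Field K] [IsAlgClosed K]
    -- `S` is a smooth connected `K`-curve
    (S : Variety K) (hSsm : IsSmooth S.structMap) (hSconn : ConnectedSpace S.X)
    (hSdim : S.dim = 1)
    -- `φ : X → S` surjective, quasi-projective `X`, all components of `X` dominating `S`,
    -- all fibres pure
    (X : Variety K) (hXqp : X.IsQuasiProjective)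
    (φ : X.X ⟶ S.X) (hφK : φ ≫ S.structMap = X.structMap)
    (hsurj : Function.Surjective φ.base)
    (hdom : ∀ T ∈ irreducibleComponents X.X, Dense (φ.base '' T))
    (hpure : ∀ s : S.X, IsPure (fiber φ s))
    -- the generic point of `S`
    (η : S.X) (hη : closure {η} = (Set.univ : Set S.X))
    -- `D` is closed, generically of fibrewise codimension one, and is the closure
    -- of its generic fibre
    (D : Set X.X) (hD : IsClosed D)
    (hgen : ∃ U : S.X.Opens, Dense (U : Set S.X) ∧
      ∀ s : S.X, s ∈ U → FibrewiseCodimOne φ D s)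
    (hclos : D = closure (D ∩ fiber φ η)) :
    ∀ s : S.X, FibrewiseCodimOne φ D s := by
  have := S.locallyOfFiniteType
  have := X.locallyOfFiniteType
  have := X.quasiCompact
  have hη' : ∀ s : S.X, η ⤳ s := fun s => specializes_iff_mem_closure.2 (by rw [hη]; trivial)
  have hS1 : trp K S.structMap η = 1 := factS K S.structMap η hη' hSdim
  have hS0 : ∀ s : S.X, s ≠ η → trp K S.structMap s = 0 := fun s hs => by
    have := factA K S.structMap η s (hη' s) (Ne.symm hs)
    omega
  have : NoetherianSpace X.X := noethX K X.structMap
  obtain ⟨U, hU, hUD⟩ := hgen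
  have hηU : η ∈ U := by
    obtain ⟨u, hu⟩ := hU.nonempty_iff.2 ⟨η⟩
    exact (hη' u).mem_open U.2 hu
  obtain ⟨d, hd⟩ := hpure η
  intro s
  exact abstract_main (fun x : X.X => φ x) φ.continuous (qsFib φ) (trp K X.structMap) (trp K S.structMap)
    (factA K X.structMap) (factA0 K X.structMap S.structMap φ hφK)
    (factB K X.structMap S.structMap φ hφK) η hη' hS1 hS0
    (factC K X.structMap S.structMap φ hφK η hη' hS0) hsurj hdom d hd D hD (hUD η hηU) hclos s

end HLpaper
end
end

section
/- Let K be an algebraically closed field, V an integral quasi-projective K-variety, and φ: V' → V a projective morphism of quasi-projective K-varieties all of whose fibres are pure of dimension m and such that every generic point of V' lies over the generic point of V. Then there exist a dense Zariski open subset U ⊆ V and a Zariski closed subset D ⊆ V'_U := φ^{-1}(U) which is a horizontal divisor relative to φ (i.e. D contains no irreducible component of any fibre of φ over U), such that V'_U ∖ D is a disjoint union of finitely many irreducible varieties, each of whose fibres over every point of U is pure and equidimensional. -/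
open AlgebraicGeometry CategoryTheory CategoryTheory.Limits TopologicalSpace

noncomputable section

namespace HLpaper

attribute [local instance] MvPolynomial.gradedAlgebra

variable {K : Type} [Field K]

/-- A morphism of `K`-varieties is projective if it factors as a closed immersion into
`ℙ^N × V` (the fibre product of `ℙ^N_K` and `V` over `Spec K`) followed by the projection
to `V`, for some `N`. -/
def IsProjectiveMorphism (V' V : Variety K) (f : V'.X ⟶ V.X) : Prop :=
  ∃ (N : ℕ) (c : V'.X ⟶ pullback (ProjSpace.structMap K N) V.structMap),
    IsClosedImmersion c ∧
    c ≫ pullback.snd (ProjSpace.structMap K N) V.structMap = f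

section RingPart
open Order Algebra
lemma dim_le_of_isIntegral {R S : Type*} [CommRing R] [CommRing S] [Algebra R S]
    [Algebra.IsIntegral R S] : ringKrullDim S ≤ ringKrullDim R := by
  refine krullDim_le_of_strictMono (PrimeSpectrum.comap (algebraMap R S)) ?_
  intro p q h
  exact Ideal.IsIntegral.comap_lt_comap (R := R) (I := p.asIdeal) (J := q.asIdeal) h

lemma le_dim_of_isIntegral {R S : Type*} [CommRing R] [CommRing S] [Algebra R S]
    [Algebra.IsIntegral R S] (hinj : Function.Injective (algebraMap R S)) :
    ringKrullDim R ≤ ringKrullDim S := by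
  refine iSup_le fun l => ?_
  obtain ⟨Q, -, hQ, hQ'⟩ := Ideal.exists_ideal_over_prime_of_isIntegral
    (S := S) (RelSeries.head l).asIdeal ⊥ (by
      change RingHom.ker (algebraMap R S) ≤ _
      rw [(RingHom.injective_iff_ker_eq_bot _).1 hinj]; exact bot_le)
  have : Q.LiesOver (RelSeries.head l).asIdeal := ⟨hQ'.symm⟩
  obtain ⟨L, hL, -⟩ := Ideal.exists_ltSeries_of_hasGoingUp l Q
  rw [← hL]
  exact le_iSup (fun (l : LTSeries (PrimeSpectrum S)) => ((l.length : ℕ) : WithBot ℕ∞)) L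

lemma dim_mvPoly (k : Type*) [Field k] (s : ℕ) :
    ringKrullDim (MvPolynomial (Fin s) k) = s := by
  simp

lemma exists_dim_eq_trdeg (k R : Type*) [Field k] [CommRing R] [IsDomain R] [Algebra k R]
    [Algebra.FiniteType k R] : ∃ s : ℕ, ringKrullDim R = s ∧ Algebra.trdeg k R = s := by
  obtain ⟨s, g, hinj, hint⟩ := exists_integral_inj_algHom_of_fg k R
  algebraize [g.toRingHom]
  have hi : Function.Injective (algebraMap (MvPolynomial (Fin s) k) R) := hinj
  have : Algebra.IsIntegral (MvPolynomial (Fin s) k) R := ⟨hint⟩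
  refine ⟨s, ?_, ?_⟩
  · rw [← dim_mvPoly k s]
    exact le_antisymm dim_le_of_isIntegral (le_dim_of_isIntegral hi)
  · have : FaithfulSMul (MvPolynomial (Fin s) k) R := (faithfulSMul_iff_algebraMap_injective _ _).2 hi
    have h := lift_trdeg_add_eq k (MvPolynomial (Fin s) k) R
    rw [trdeg_eq_zero (R := MvPolynomial (Fin s) k), MvPolynomial.trdeg_of_isDomain] at h
    simp at h
    exact h.symm

lemma dim_away (k R S : Type*) [Field k] [CommRing R] [IsDomain R] [Algebra k R]
    [Algebra.FiniteType k R] [CommRing S] [Algebra R S] (f : R) (hf : f ≠ 0)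
    [IsLocalization.Away f S] : ringKrullDim S = ringKrullDim R := by
  have hM : Submonoid.powers f ≤ nonZeroDivisors R := powers_le_nonZeroDivisors_of_noZeroDivisors hf
  have : IsDomain S := IsLocalization.isDomain_of_le_nonZeroDivisors _ hM
  let _ : Algebra k S := ((algebraMap R S).comp (algebraMap k R)).toAlgebra
  have : IsScalarTower k R S := .of_algebraMap_eq fun _ => rfl
  have hi : Function.Injective (algebraMap R S) := IsLocalization.injective S hM
  have : FaithfulSMul R S := (faithfulSMul_iff_algebraMap_injective _ _).2 hi
  have : Algebra.FiniteType R S := IsLocalization.finiteType_of_monoid_fg (Submonoid.powers f) S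
  have : Algebra.FiniteType k S := .trans (S := R) inferInstance inferInstance
  have : Algebra.IsAlgebraic R S := IsLocalization.isAlgebraic _ (Submonoid.powers f)
  obtain ⟨s, h1, h2⟩ := exists_dim_eq_trdeg k R
  obtain ⟨t, h3, h4⟩ := exists_dim_eq_trdeg k S
  have h := lift_trdeg_add_eq k R S
  rw [trdeg_eq_zero (R := R), h2, h4] at h
  simp at h
  rw [h1, h3, h]

open TensorProduct
section
attribute [local instance] Algebra.TensorProduct.rightAlgebra MvPolynomial.algebraMvPolynomial

lemma exists_fiber_dim_lt (A C : Type*) [CommRing A] [IsDomain A] [CommRing C] [Algebra A C]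
    [Algebra.FiniteType A C] (m : WithBot ℕ∞) (hm0 : ⊥ < m)
    (hm : ringKrullDim ((⊥ : Ideal A).Fiber C) < m) :
    ∃ a : A, a ≠ 0 ∧ ∀ p : PrimeSpectrum A, a ∉ p.asIdeal →
      ringKrullDim (p.asIdeal.Fiber C) < m := by
  rcases subsingleton_or_nontrivial ((⊥ : Ideal A).Fiber C) with hs | hn
  · have h1 : algebraMap C ((⊥ : Ideal A).Fiber C) 1 = algebraMap C _ 0 := Subsingleton.elim _ _
    rw [map_zero, IsLocalization.map_eq_zero_iff
      (Algebra.algebraMapSubmonoid C (nonZeroDivisors A))] at h1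
    obtain ⟨⟨_, a, ha, rfl⟩, h⟩ := h1
    refine ⟨a, nonZeroDivisors.ne_zero ha, fun p hp => ?_⟩
    have h0 : algebraMap A C a = 0 := by simpa using h
    have : (1 : p.asIdeal.Fiber C) = 0 := by
      have hu : algebraMap A p.asIdeal.ResidueField a ≠ 0 := by
        simpa using hp
      have h2 : algebraMap A (p.asIdeal.Fiber C) a = 0 := by
        rw [IsScalarTower.algebraMap_apply A C, h0, map_zero]
      rw [IsScalarTower.algebraMap_apply A p.asIdeal.ResidueField] at h2
      have h3 := (IsUnit.mk0 _ hu).map (algebraMap _ (p.asIdeal.Fiber C))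
      rw [h2] at h3
      exact (isUnit_zero_iff.1 h3).symm
    have : Subsingleton (p.asIdeal.Fiber C) := subsingleton_of_zero_eq_one this.symm
    rw [ringKrullDim_eq_bot_of_subsingleton]
    exact hm0
  · set L := (⊥ : Ideal A).ResidueField with hL
    obtain ⟨s, g, hinj, hint⟩ := exists_integral_inj_algHom_of_fg L ((⊥ : Ideal A).Fiber C)
    have hsm : (s : WithBot ℕ∞) < m := by
      refine lt_of_le_of_lt ?_ hm
      algebraize [g.toRingHom]
      have : Algebra.IsIntegral (MvPolynomial (Fin s) L) ((⊥ : Ideal A).Fiber C) := ⟨hint⟩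
      rw [← dim_mvPoly L s]
      exact le_dim_of_isIntegral hinj
    choose r hr c hc using fun i => Ideal.Fiber.exists_smul_eq_one_tmul (⊥ : Ideal A) (g (.X i))
    have hr' : ∀ i, algebraMap A L (r i) ≠ 0 := fun i => by
      simpa using hr i
    let ψ (p : PrimeSpectrum A) : MvPolynomial (Fin s) p.asIdeal.ResidueField →ₐ[p.asIdeal.ResidueField]
      p.asIdeal.Fiber C := MvPolynomial.aeval fun i => 1 ⊗ₜ c i
    let γ : MvPolynomial (Fin s) A →ₐ[A] C := MvPolynomial.aeval c
    have hcomm (p : PrimeSpectrum A) : (ψ p).toRingHom.comp (MvPolynomial.map (algebraMap A p.asIdeal.ResidueField))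
        = (algebraMap C (p.asIdeal.Fiber C)).comp γ.toRingHom := by
      apply MvPolynomial.ringHom_ext
      · intro a
        simp only [AlgHom.toRingHom_eq_coe, RingHom.comp_apply, MvPolynomial.map_C, RingHom.coe_coe,
          MvPolynomial.algHom_C, γ]
        rw [← IsScalarTower.algebraMap_apply A C, ← IsScalarTower.algebraMap_apply]
      · intro i
        simp [ψ, γ]
        rfl
    have hψ : (ψ ⟨⊥, inferInstance⟩).toRingHom.IsIntegral := by
      let h : MvPolynomial (Fin s) L →ₐ[L] MvPolynomial (Fin s) L :=
        MvPolynomial.aeval fun i => MvPolynomial.C (algebraMap A L (r i))⁻¹ * .X i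
      have e : (ψ ⟨⊥, inferInstance⟩).comp h = g := by
        apply MvPolynomial.algHom_ext
        intro i
        have : (algebraMap A L (r i)) • g (.X i) = 1 ⊗ₜ c i := by
          rw [← hc i, algebraMap_smul]
        simp only [AlgHom.comp_apply, h, MvPolynomial.aeval_X, map_mul, ψ, ← this,
          MvPolynomial.algHom_C]
        rw [← Algebra.smul_def, smul_smul, inv_mul_cancel₀ (hr' i), one_smul]
      refine RingHom.IsIntegral.tower_top h.toRingHom _ ?_
      have : (ψ ⟨⊥, inferInstance⟩).toRingHom.comp h.toRingHom = g.toRingHom := by rw [← e]; rfl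
      rw [this]; exact hint
    have key : ∀ t : C, ∃ a : A, a ≠ 0 ∧ γ.toRingHom.IsIntegralElem (algebraMap A C a * t) := by
      intro t
      let P0 : PrimeSpectrum A := ⟨⊥, inferInstance⟩
      let F := P0.asIdeal.Fiber C
      let _ : Algebra (MvPolynomial (Fin s) A) C := γ.toRingHom.toAlgebra
      let _ : Algebra (MvPolynomial (Fin s) L) F := (ψ P0).toRingHom.toAlgebra
      let _ : Algebra (MvPolynomial (Fin s) A) F :=
        ((algebraMap C F).comp γ.toRingHom).toAlgebra
      have : IsScalarTower (MvPolynomial (Fin s) A) C F := .of_algebraMap_eq fun _ => rfl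
      have : IsScalarTower (MvPolynomial (Fin s) A) (MvPolynomial (Fin s) L) F :=
        .of_algebraMap_eq' (hcomm P0).symm
      let M := (nonZeroDivisors A).map (MvPolynomial.C (σ := Fin s))
      have : IsLocalization M (MvPolynomial (Fin s) L) := MvPolynomial.isLocalization _ _
      obtain ⟨⟨_, a, ha, rfl⟩, h1⟩ := IsIntegral.exists_multiple_integral_of_isLocalization M
        (algebraMap C F t) (hψ _)
      have hγC (a : A) : algebraMap (MvPolynomial (Fin s) A) C (MvPolynomial.C a) =
          algebraMap A C a := MvPolynomial.algHom_C γ a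
      have hM : Algebra.algebraMapSubmonoid C M =
          Algebra.algebraMapSubmonoid C (nonZeroDivisors A) := by
        ext x
        simp only [Algebra.algebraMapSubmonoid, M, Submonoid.mem_map, exists_exists_and_eq_and, hγC]
      have : IsLocalization (Algebra.algebraMapSubmonoid C M) F := by
        rw [hM]
        infer_instance
      have h2 : IsIntegral (MvPolynomial (Fin s) A)
        (algebraMap C F ((MvPolynomial.C a : MvPolynomial (Fin s) A) • t)) := by
        rw [Algebra.smul_def, map_mul, ← IsScalarTower.algebraMap_apply, ← Algebra.smul_def]
        exact h1
      obtain ⟨_, ⟨b, hb, rfl⟩, h3⟩ := IsLocalization.exists_isIntegral_smul_of_isIntegral_map M h2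
      refine ⟨b * a, mul_ne_zero (nonZeroDivisors.ne_zero hb) (nonZeroDivisors.ne_zero ha), ?_⟩
      rw [Algebra.smul_def, Algebra.smul_def, hγC, hγC, ← mul_assoc, ← map_mul] at h3
      exact h3
    obtain ⟨G, hG⟩ := (inferInstance : Algebra.FiniteType A C).1
    choose α hα hαi using key
    refine ⟨∏ t ∈ G, α t, Finset.prod_ne_zero_iff.2 fun t _ => hα t, fun p hp => ?_⟩
    refine lt_of_le_of_lt ?_ hsm
    rw [← dim_mvPoly p.asIdeal.ResidueField s]
    algebraize [(ψ p).toRingHom]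
    have : Algebra.IsIntegral (MvPolynomial (Fin s) p.asIdeal.ResidueField) (p.asIdeal.Fiber C) := by
      have hCp (l : p.asIdeal.ResidueField) : algebraMap _ (p.asIdeal.Fiber C) l =
          algebraMap (MvPolynomial (Fin s) p.asIdeal.ResidueField) _ (MvPolynomial.C l) :=
        (MvPolynomial.algHom_C (ψ p) l).symm
      have hgen : ∀ t ∈ G, IsIntegral (MvPolynomial (Fin s) p.asIdeal.ResidueField)
          (algebraMap C (p.asIdeal.Fiber C) t) := by
        intro t ht
        have h1 : IsIntegral (MvPolynomial (Fin s) p.asIdeal.ResidueField)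
          (algebraMap C (p.asIdeal.Fiber C) (algebraMap A C (α t) * t)) := by
          let _ : Algebra (MvPolynomial (Fin s) A) C := γ.toRingHom.toAlgebra
          exact IsIntegral.map_of_comp_eq _ _ (hcomm p) (hαi t)
        have hu : algebraMap A p.asIdeal.ResidueField (α t) ≠ 0 := by
          have : α t ∉ p.asIdeal := fun h => hp (Ideal.mem_of_dvd _ (Finset.dvd_prod_of_mem _ ht) h)
          simpa using this
        have h2 : IsIntegral (MvPolynomial (Fin s) p.asIdeal.ResidueField)
          (algebraMap _ (p.asIdeal.Fiber C) (algebraMap A p.asIdeal.ResidueField (α t))⁻¹) := by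
          rw [hCp]
          exact isIntegral_algebraMap
        have h3 : algebraMap C (p.asIdeal.Fiber C) t =
            algebraMap _ (p.asIdeal.Fiber C) (algebraMap A p.asIdeal.ResidueField (α t))⁻¹ *
            algebraMap C (p.asIdeal.Fiber C) (algebraMap A C (α t) * t) := by
          rw [map_mul, ← mul_assoc, ← IsScalarTower.algebraMap_apply A C,
            IsScalarTower.algebraMap_apply A p.asIdeal.ResidueField (p.asIdeal.Fiber C),
            ← map_mul, inv_mul_cancel₀ hu, map_one, one_mul]
        rw [h3]
        exact h2.mul h1
      have hall : ∀ t : C, IsIntegral (MvPolynomial (Fin s) p.asIdeal.ResidueField)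
          (algebraMap C (p.asIdeal.Fiber C) t) := by
        intro t
        have : t ∈ Algebra.adjoin A (G : Set C) := by rw [hG]; trivial
        induction this using Algebra.adjoin_induction with
        | mem t ht => exact hgen t ht
        | algebraMap a =>
          rw [← IsScalarTower.algebraMap_apply A C,
            IsScalarTower.algebraMap_apply A p.asIdeal.ResidueField (p.asIdeal.Fiber C), hCp]
          exact isIntegral_algebraMap
        | add x y _ _ hx hy => rw [map_add]; exact hx.add hy
        | mul x y _ _ hx hy => rw [map_mul]; exact hx.mul hy
      constructor
      intro x
      induction x using TensorProduct.induction_on with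
      | zero => exact isIntegral_zero
      | add x y hx hy => exact hx.add hy
      | tmul l t =>
        have : l ⊗ₜ[A] t = algebraMap _ (p.asIdeal.Fiber C) l * algebraMap C (p.asIdeal.Fiber C) t := by
          rw [Algebra.TensorProduct.algebraMap_apply, Algebra.TensorProduct.right_algebraMap_apply,
            Algebra.TensorProduct.tmul_mul_tmul]
          simp
        rw [this, hCp]
        exact isIntegral_algebraMap.mul (hall t)
    exact dim_le_of_isIntegral
end
end RingPart
open Topology
section Topo

lemma dim_mono_set {X : Type*} [TopologicalSpace X] {A B : Set X} (h : A ⊆ B) :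
    topologicalKrullDim A ≤ topologicalKrullDim B :=
  (Topology.IsEmbedding.inclusion h).isInducing.topologicalKrullDim_le

lemma dim_image {X Y : Type*} [TopologicalSpace X] [TopologicalSpace Y] {e : X → Y}
    (he : Topology.IsEmbedding e) (A : Set X) :
    topologicalKrullDim ↥(e '' A) = topologicalKrullDim A :=
  (IsHomeomorph.topologicalKrullDim_eq _ (he.homeomorphImage A).isHomeomorph).symm

lemma le_dim_iff (X : Type*) [TopologicalSpace X] [QuasiSober X] [T0Space X] (n : ℕ) :
    (n : WithBot ℕ∞) ≤ topologicalKrullDim X ↔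
      ∃ f : ℕ → X, ∀ i < n, f (i + 1) ⤳ f i ∧ ¬ f i ⤳ f (i + 1) := by
  have hle : ∀ Z W : IrreducibleCloseds X, Z ≤ W ↔
      W.2.genericPoint ⤳ Z.2.genericPoint := by
    intro Z W
    have hZ := Z.2.isGenericPoint_genericPoint Z.3
    have hW := W.2.isGenericPoint_genericPoint W.3
    rw [hW.specializes_iff_mem]
    exact (hZ.mem_closed_set_iff W.3).symm
  unfold topologicalKrullDim
  rw [Order.le_krullDim_iff]
  constructor
  · rintro ⟨l, hl⟩
    refine ⟨fun i => (l ⟨min i n, by omega⟩).2.genericPoint, fun i hi => ?_⟩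
    have hlt : l ⟨min i n, by omega⟩ < l ⟨min (i+1) n, by omega⟩ := by
      apply l.strictMono
      simp only [Fin.mk_lt_mk]
      omega
    rw [lt_iff_le_not_ge, hle, hle] at hlt
    exact hlt
  · rintro ⟨f, hf⟩
    refine ⟨⟨n, fun i => ⟨closure {f i}, isIrreducible_singleton.closure, isClosed_closure⟩, ?_⟩, rfl⟩
    intro i
    have := hf i i.2
    rw [specializes_iff_closure_subset, specializes_iff_closure_subset] at this
    exact this

lemma dim_le_of_local (X : Type*) [TopologicalSpace X] [QuasiSober X] [T0Space X] (N : WithBot ℕ∞)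
    (h : ∀ x : X, ∃ U : Set X, IsOpen U ∧ x ∈ U ∧ topologicalKrullDim U ≤ N) :
    topologicalKrullDim X ≤ N := by
  have key : ∀ n : ℕ, (n : WithBot ℕ∞) ≤ topologicalKrullDim X → (n : WithBot ℕ∞) ≤ N := by
    intro n hn
    obtain ⟨f, hf⟩ := (le_dim_iff X n).1 hn
    obtain ⟨U, hU, hx, hN⟩ := h (f 0)
    refine le_trans ?_ hN
    have : QuasiSober U := hU.isOpenEmbedding_subtypeVal.quasiSober
    have hm : ∀ i ≤ n, f i ∈ U := by
      intro i
      induction i with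
      | zero => intro _; exact hx
      | succ i ih => intro hi; exact (hf i (by omega)).1.mem_open hU (ih (by omega))
    refine (le_dim_iff U n).2 ⟨fun i => ⟨f (min i n), hm _ (by omega)⟩, fun i hi => ?_⟩
    have := hf i hi
    rw [← IsInducing.subtypeVal.specializes_iff, ← IsInducing.subtypeVal.specializes_iff]
    have e1 : min i n = i := by omega
    have e2 : min (i+1) n = i+1 := by omega
    simpa only [e1, e2] using this
  refine iSup_le fun l => key _ ?_
  exact Order.le_krullDim_iff.2 ⟨l, rfl⟩

lemma exists_generic_component {X : Type*} [TopologicalSpace X] [QuasiSober X] (x : X) :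
    ∃ y, y ⤳ x ∧ closure {y} ∈ irreducibleComponents X := by
  obtain ⟨T, hT, hxT⟩ := exists_mem_irreducibleComponents_subset_of_isIrreducible {x}
    isIrreducible_singleton
  have hg := hT.1.isGenericPoint_genericPoint (isClosed_of_mem_irreducibleComponents T hT)
  exact ⟨hT.1.genericPoint, hg.specializes (hxT rfl), by rw [hg.def]; exact hT⟩

lemma mem_comp_iff {X : Type*} [TopologicalSpace X] [QuasiSober X] (x : X) :
    closure {x} ∈ irreducibleComponents X ↔ ∀ y, y ⤳ x → x ⤳ y := by
  constructor
  · intro h y hy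
    have := h.2 (isIrreducible_singleton (x := y)).closure (specializes_iff_closure_subset.1 hy)
    exact specializes_iff_closure_subset.2 this
  · intro h
    obtain ⟨y, hy, hc⟩ := exists_generic_component x
    have : closure {x} = closure {y} :=
      (specializes_iff_closure_subset.1 hy).antisymm (specializes_iff_closure_subset.1 (h y hy))
    rwa [this]

lemma exists_gen_of_mem_comp {X : Type*} [TopologicalSpace X] [QuasiSober X] {T : Set X}
    (hT : T ∈ irreducibleComponents X) : ∃ x, T = closure {x} :=
  ⟨hT.1.genericPoint,
    ((hT.1.isGenericPoint_genericPoint (isClosed_of_mem_irreducibleComponents T hT)).def).symm⟩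

lemma dim_closed_lt {X : Type*} [TopologicalSpace X] [QuasiSober X] [T0Space X] (m : ℕ)
    (hX : IsPureOfDim X (m : ℕ∞)) {Y : Set X} (hY : IsClosed Y)
    (h : ∀ x, closure {x} ∈ irreducibleComponents X → x ∉ Y) :
    topologicalKrullDim Y < (m : WithBot ℕ∞) := by
  by_contra hcon
  rw [not_lt] at hcon
  have : QuasiSober Y := hY.isClosedEmbedding_subtypeVal.quasiSober
  obtain ⟨f, hf⟩ := (le_dim_iff Y m).1 hcon
  obtain ⟨y, hy, hc⟩ := exists_generic_component (f m : X)
  have hd := hX _ hc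
  have hym : ¬ (f m : X) ⤳ y := fun hh => h y hc (hh.mem_closed hY (f m).2)
  have hcl : ∀ i ≤ m, y ⤳ (f i : X) := by
    intro i hi
    have : ∀ j ≤ m, (f m : X) ⤳ f (m - j) := by
      intro j
      induction j with
      | zero => intro _; exact specializes_rfl
      | succ j ih =>
        intro hj
        refine (ih (by omega)).trans ?_
        have := (hf (m - (j+1)) (by omega)).1
        rw [← IsInducing.subtypeVal.specializes_iff] at this
        have e : m - (j + 1) + 1 = m - j := by omega
        rwa [e] at this
    have := this (m - i) (by omega)
    have e : m - (m - i) = i := by omega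
    rw [e] at this
    exact hy.trans this
  have : QuasiSober ↥(closure {y}) := isClosed_closure.isClosedEmbedding_subtypeVal.quasiSober
  have h2 : ((m + 1 : ℕ) : WithBot ℕ∞) ≤ topologicalKrullDim ↥(closure {y}) := by
    rw [le_dim_iff]
    refine ⟨fun i => if hi : i ≤ m then ⟨f i, (hcl i hi).mem_closure⟩ else
      ⟨y, subset_closure rfl⟩, fun i hi => ?_⟩
    rw [← IsInducing.subtypeVal.specializes_iff, ← IsInducing.subtypeVal.specializes_iff]
    have hi' : i ≤ m := by omega
    by_cases hi2 : i + 1 ≤ m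
    · simp only [hi', hi2, dif_pos]
      rw [IsInducing.subtypeVal.specializes_iff, IsInducing.subtypeVal.specializes_iff]
      exact hf i hi2
    · simp only [hi', hi2, dif_pos]
      have : i = m := by omega
      subst this
      exact ⟨hy, hym⟩
  rw [hd] at h2
  have : m + 1 ≤ m := by exact_mod_cast h2
  omega

def PropP (X : Type*) [TopologicalSpace X] : Prop :=
  ∀ (x : X) (O : Set X), IsOpen O → x ∈ O →
    topologicalKrullDim ↥(closure {x} ∩ O) = topologicalKrullDim ↥(closure {x})

lemma PropP.of_homeo {X Y : Type*} [TopologicalSpace X] [TopologicalSpace Y] (e : X ≃ₜ Y)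
    (h : PropP X) : PropP Y := by
  intro y O hO hy
  have h1 := h (e.symm y) (e ⁻¹' O) (hO.preimage e.continuous) (by simpa using hy)
  rw [← dim_image e.isEmbedding, ← dim_image e.isEmbedding (closure _),
    Set.image_inter e.injective, e.image_closure, e.image_preimage,
    Set.image_singleton, e.apply_symm_apply] at h1
  exact h1

lemma IsPureOfDim.of_homeo {X Y : Type*} [TopologicalSpace X] [TopologicalSpace Y] (e : X ≃ₜ Y)
    {d : WithBot ℕ∞} (h : IsPureOfDim X d) : IsPureOfDim Y d := by
  intro T hT
  have : e ⁻¹' T ∈ irreducibleComponents X :=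
    preimage_mem_irreducibleComponents hT e.isOpenEmbedding (by
      rw [e.surjective.range_eq, Set.inter_univ]; exact hT.1.1)
  rw [← h _ this, ← dim_image e.isEmbedding, e.image_preimage]

lemma IsPureOfDim.open_sub {X : Type*} [TopologicalSpace X] [QuasiSober X] (hP : PropP X)
    {d : WithBot ℕ∞} (h : IsPureOfDim X d) {O : Set X} (hO : IsOpen O) : IsPureOfDim ↥O d := by
  have : QuasiSober O := hO.isOpenEmbedding_subtypeVal.quasiSober
  intro T hT
  obtain ⟨t, rfl⟩ := exists_gen_of_mem_comp hT
  rw [mem_comp_iff] at hT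
  have ht : closure {(t : X)} ∈ irreducibleComponents X := by
    rw [mem_comp_iff]
    intro y hy
    have := hT ⟨y, hy.mem_open hO t.2⟩ (by rwa [← IsInducing.subtypeVal.specializes_iff])
    rwa [← IsInducing.subtypeVal.specializes_iff] at this
  rw [← h _ ht, ← hP t O hO t.2, ← dim_image IsEmbedding.subtypeVal (closure {t})]
  have : Subtype.val '' closure {t} = closure {(t : X)} ∩ O := by
    rw [IsInducing.subtypeVal.closure_eq_preimage_closure_image, Subtype.image_preimage_coe,
      Set.image_singleton, Set.inter_comm]
  rw [this]

end Topo
section Aff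

lemma dim_range {X Y : Type*} [TopologicalSpace X] [TopologicalSpace Y] {e : X → Y}
    (he : Topology.IsEmbedding e) :
    topologicalKrullDim ↥(Set.range e) = topologicalKrullDim X := 
  (IsHomeomorph.topologicalKrullDim_eq _ he.toHomeomorph.isHomeomorph).symm

lemma affine_dim (k R : Type*) [Field k] [CommRing R] [Algebra k R] [Algebra.FiniteType k R]
    (q : PrimeSpectrum R) (O : Set (PrimeSpectrum R)) (hO : IsOpen O) (hq : q ∈ O) :
    topologicalKrullDim ↥(closure {q} ∩ O) = ringKrullDim (R ⧸ q.asIdeal) := by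
  have he := (PrimeSpectrum.isClosedEmbedding_comap_of_surjective (R ⧸ q.asIdeal)
    (Ideal.Quotient.mk q.asIdeal) Ideal.Quotient.mk_surjective).isEmbedding
  have hr : Set.range (PrimeSpectrum.comap (Ideal.Quotient.mk q.asIdeal)) = closure {q} := by
    rw [range_comap_of_surjective _ _ Ideal.Quotient.mk_surjective,
      Ideal.mk_ker, PrimeSpectrum.closure_singleton]
  apply le_antisymm
  · refine (dim_mono_set Set.inter_subset_left).trans ?_
    rw [← hr, dim_range he, PrimeSpectrum.topologicalKrullDim_eq_ringKrullDim]
  · obtain ⟨_, ⟨f, rfl⟩, hf, hfO⟩ :=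
      PrimeSpectrum.isTopologicalBasis_basic_opens.exists_subset_of_mem_open hq hO
    refine le_trans ?_ (dim_mono_set (Set.inter_subset_inter_right _ hfO))
    have hf0 : Ideal.Quotient.mk q.asIdeal f ≠ 0 := by
      rw [Ne, Ideal.Quotient.eq_zero_iff_mem]; exact hf
    rw [← dim_away k (R ⧸ q.asIdeal) (Localization.Away (Ideal.Quotient.mk q.asIdeal f)) _ hf0,
      ← PrimeSpectrum.topologicalKrullDim_eq_ringKrullDim]
    have hl := (PrimeSpectrum.localization_away_isOpenEmbedding
      (Localization.Away (Ideal.Quotient.mk q.asIdeal f)) (Ideal.Quotient.mk q.asIdeal f)).isEmbedding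
    rw [← dim_range (he.comp hl)]
    apply dim_mono_set
    rw [Set.range_comp, PrimeSpectrum.localization_away_comap_range
      (Localization.Away (Ideal.Quotient.mk q.asIdeal f)) (Ideal.Quotient.mk q.asIdeal f)]
    rintro _ ⟨y, hy, rfl⟩
    refine ⟨hr ▸ Set.mem_range_self _, ?_⟩
    exact hy

end Aff
section SchemeP

lemma affine_chart_dim {k : Type} [Field k] {F : Scheme.{0}} (g : F ⟶ SpecOf k)
    [LocallyOfFiniteType g] (x : F) {U : F.Opens} (hU : IsAffineOpen U) (hx : x ∈ U) :
    ∃ d : WithBot ℕ∞, ∀ O : Set F, IsOpen O → x ∈ O →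
      topologicalKrullDim ↥(closure {x} ∩ ((U : Set F) ∩ O)) = d := by
  obtain ⟨q, rfl⟩ : x ∈ Set.range hU.fromSpec := by rw [hU.range_fromSpec]; exact hx
  have hft : (g.appLE ⊤ U le_top).hom.FiniteType :=
    LocallyOfFiniteType.finiteType_appLE g (isAffineOpen_top _) hU le_top
  let ψ : k →+* Γ(F, U) := (g.appLE ⊤ U le_top).hom.comp (Scheme.ΓSpecIso (.of k)).inv.hom
  have hψ : ψ.FiniteType := hft.comp
    (RingHom.FiniteType.of_surjective _ (ConcreteCategory.bijective_of_isIso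
      (Scheme.ΓSpecIso (.of k)).inv).2)
  let _ : Algebra k Γ(F, U) := ψ.toAlgebra
  have : Algebra.FiniteType k Γ(F, U) := hψ
  refine ⟨ringKrullDim (Γ(F, U) ⧸ q.asIdeal), fun O hO hxO => ?_⟩
  have he := hU.fromSpec.isOpenEmbedding
  have h1 : closure {hU.fromSpec q} ∩ ((U : Set F) ∩ O) =
      hU.fromSpec '' (closure {q} ∩ hU.fromSpec ⁻¹' O) := by
    rw [Set.image_inter_preimage, he.isInducing.closure_eq_preimage_closure_image,
      Set.image_preimage_eq_inter_range, hU.range_fromSpec, Set.image_singleton, Set.inter_assoc]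
  rw [h1]
  exact (dim_image he.isEmbedding _).trans
    (affine_dim k Γ(F, U) q (hU.fromSpec ⁻¹' O) (hO.preimage hU.fromSpec.continuous) hxO)

lemma propP_scheme {k : Type} [Field k] {F : Scheme.{0}} (g : F ⟶ SpecOf k)
    [LocallyOfFiniteType g] : PropP F := by
  intro x O hO hx
  apply le_antisymm (dim_mono_set Set.inter_subset_left)
  have : QuasiSober ↥(closure {x}) := isClosed_closure.isClosedEmbedding_subtypeVal.quasiSober
  apply dim_le_of_local
  rintro ⟨y, hy⟩
  obtain ⟨_, ⟨U, hU, rfl⟩, hyU, -⟩ := (F.isBasis_affineOpens).exists_subset_of_mem_open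
    (Set.mem_univ y) isOpen_univ
  have hxU : x ∈ U := (specializes_iff_mem_closure.2 hy).mem_open U.2 hyU
  refine ⟨Subtype.val ⁻¹' (U : Set F), U.2.preimage continuous_subtype_val, hyU, ?_⟩
  rw [← dim_image IsEmbedding.subtypeVal, Subtype.image_preimage_coe]
  obtain ⟨d, hd⟩ := affine_chart_dim g x hU hxU
  have h1 := hd Set.univ isOpen_univ trivial
  have h2 := hd O hO hx
  rw [Set.inter_univ] at h1
  rw [h1, ← h2]
  exact dim_mono_set (Set.inter_subset_inter_right _ Set.inter_subset_right)

lemma lft_snd {X Y S : Scheme.{0}} (f : X ⟶ S) (g : Y ⟶ S) [LocallyOfFiniteType f] :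
    LocallyOfFiniteType (pullback.snd f g) := inferInstance

lemma propP_fiber {X Y : Scheme.{0}} (f : X ⟶ Y) [LocallyOfFiniteType f] (y : Y) :
    PropP (fiber f y) := by
  have : LocallyOfFiniteType (f.fiberToSpecResidueField y) := lft_snd f _
  exact PropP.of_homeo (f.fiberHomeo y) (propP_scheme (k := Y.residueField y)
    (f.fiberToSpecResidueField y))

lemma sober_fiber {X Y : Scheme.{0}} (f : X ⟶ Y) (y : Y) : QuasiSober (fiber f y) :=
  (f.fiberHomeo y).symm.isClosedEmbedding.quasiSober

end SchemeP
section Chart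

lemma chart_dim {X Y : Scheme.{0}} (φ : X ⟶ Y) [LocallyOfFiniteType φ] {V₀ : Y.Opens}
    (hV₀ : IsAffineOpen V₀) {W : X.Opens} (hW : IsAffineOpen W) (hWV : W ≤ φ ⁻¹ᵁ V₀)
    {Z : Set X} (hZ : IsClosed Z) :
    ∃ (C : Type) (_ : CommRing C) (_ : Algebra Γ(Y, V₀) C), Algebra.FiniteType Γ(Y, V₀) C ∧
      ∀ p : PrimeSpectrum Γ(Y, V₀),
        topologicalKrullDim ↥(Z ∩ W ∩ fiber φ (hV₀.fromSpec p)) =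
          ringKrullDim (p.asIdeal.Fiber C) := by
  have hcl : IsClosed (X := PrimeSpectrum Γ(X, W)) (hW.fromSpec ⁻¹' Z) :=
    hZ.preimage hW.fromSpec.continuous
  obtain ⟨I, hI⟩ := (PrimeSpectrum.isClosed_iff_zeroLocus_ideal _).1 hcl
  let ψ : Γ(Y, V₀) →+* (Γ(X, W) ⧸ I) :=
    (Ideal.Quotient.mk I).comp (φ.appLE V₀ W hWV).hom
  have hψ : ψ.FiniteType :=
    (RingHom.FiniteType.of_surjective _ Ideal.Quotient.mk_surjective).comp
      (LocallyOfFiniteType.finiteType_appLE φ hV₀ hW hWV)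
  refine ⟨Γ(X, W) ⧸ I, inferInstance, ψ.toAlgebra, hψ, fun p => ?_⟩
  let _ := ψ.toAlgebra
  have he1 : IsEmbedding (PrimeSpectrum.comap (Ideal.Quotient.mk I)) :=
    (PrimeSpectrum.isClosedEmbedding_comap_of_surjective _ (Ideal.Quotient.mk I)
      Ideal.Quotient.mk_surjective).isEmbedding
  let w : PrimeSpectrum Γ(X, W) → X := fun q => hW.fromSpec q
  have hw : IsEmbedding w := hW.fromSpec.isOpenEmbedding.isEmbedding
  have hrw : Set.range w = W := hW.range_fromSpec
  have hr1 : Set.range (PrimeSpectrum.comap (Ideal.Quotient.mk I)) = w ⁻¹' Z := by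
    rw [range_comap_of_surjective _ _ Ideal.Quotient.mk_surjective, Ideal.mk_ker, ← hI]
    rfl
  have hcomm : ∀ q : PrimeSpectrum Γ(X, W),
      hV₀.fromSpec (PrimeSpectrum.comap (φ.appLE V₀ W hWV).hom q) = φ (w q) := by
    intro q
    have := hV₀.SpecMap_appLE_fromSpec φ hW hWV
    have h2 := congr($(this) q)
    simpa using! h2
  have hset : Z ∩ W ∩ fiber φ (hV₀.fromSpec p) =
      (w ∘ PrimeSpectrum.comap (Ideal.Quotient.mk I)) ''
        (PrimeSpectrum.comap (algebraMap Γ(Y, V₀) (Γ(X, W) ⧸ I)) ⁻¹' {p}) := by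
    ext x
    constructor
    · rintro ⟨⟨hxZ, hxW⟩, hxu⟩
      obtain ⟨q, rfl⟩ : x ∈ Set.range w := by rw [hrw]; exact hxW
      obtain ⟨r, rfl⟩ : q ∈ Set.range (PrimeSpectrum.comap (Ideal.Quotient.mk I)) := by
        rw [hr1]; exact hxZ
      refine ⟨r, ?_, rfl⟩
      have h3 : φ (w (PrimeSpectrum.comap (Ideal.Quotient.mk I) r)) = hV₀.fromSpec p := hxu
      rw [← hcomm] at h3
      exact hV₀.fromSpec.isOpenEmbedding.injective h3
    · rintro ⟨r, hr, rfl⟩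
      refine ⟨⟨?_, ?_⟩, ?_⟩
      · have : PrimeSpectrum.comap (Ideal.Quotient.mk I) r ∈ w ⁻¹' Z := by
          rw [← hr1]; exact Set.mem_range_self _
        exact this
      · rw [← hrw]; exact Set.mem_range_self _
      · have hr' : PrimeSpectrum.comap ψ r = p := hr
        have := hcomm (PrimeSpectrum.comap (Ideal.Quotient.mk I) r)
        change φ _ = _
        rw [← hr']
        exact this.symm
  rw [hset, dim_image (hw.comp he1), ← PrimeSpectrum.topologicalKrullDim_eq_ringKrullDim]
  exact IsHomeomorph.topologicalKrullDim_eq _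
    (PrimeSpectrum.preimageHomeomorphFiber Γ(Y, V₀) (Γ(X, W) ⧸ I) p).isHomeomorph

lemma chart_open {X Y : Scheme.{0}} [IsIntegral Y] (φ : X ⟶ Y) [LocallyOfFiniteType φ]
    {V₀ : Y.Opens} (hV₀ : IsAffineOpen V₀) {W : X.Opens} (hW : IsAffineOpen W)
    (hWV : W ≤ φ ⁻¹ᵁ V₀) {Z : Set X} (hZ : IsClosed Z) (η : Y)
    (hη : closure {η} = (Set.univ : Set Y)) (hηV : η ∈ V₀) (m : ℕ)
    (hm : topologicalKrullDim ↥(Z ∩ W ∩ fiber φ η) < (m : WithBot ℕ∞)) :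
    ∃ U : Y.Opens, η ∈ U ∧ U ≤ V₀ ∧ ∀ u ∈ U,
      topologicalKrullDim ↥(Z ∩ W ∩ fiber φ u) < (m : WithBot ℕ∞) := by
  obtain ⟨C, _, _, hC, hdim⟩ := chart_dim φ hV₀ hW hWV hZ
  have : Nonempty V₀ := ⟨⟨η, hηV⟩⟩
  have hbot : hV₀.fromSpec (⟨⊥, Ideal.isPrime_bot⟩ : PrimeSpectrum Γ(Y, V₀)) = η := by
    obtain ⟨q, hq⟩ : η ∈ Set.range hV₀.fromSpec := by rw [hV₀.range_fromSpec]; exact hηV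
    have h1 : η ⤳ hV₀.fromSpec (⟨⊥, Ideal.isPrime_bot⟩ : PrimeSpectrum Γ(Y, V₀)) := by
      rw [specializes_iff_mem_closure, hη]; trivial
    rw [← hq] at h1
    replace h1 := hV₀.fromSpec.isOpenEmbedding.isInducing.specializes_iff.1 h1
    have h2 : q.asIdeal ≤ ⊥ := (PrimeSpectrum.le_iff_specializes q ⟨⊥, Ideal.isPrime_bot⟩).2 h1
    rw [← hq]
    congr 1
    exact (PrimeSpectrum.ext (le_bot_iff.1 h2)).symm
  rw [← hbot, hdim] at hm
  obtain ⟨a, ha, hfa⟩ := exists_fiber_dim_lt Γ(Y, V₀) C m (WithBot.bot_lt_coe _) hm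
  have hmem : ∀ p : PrimeSpectrum Γ(Y, V₀), hV₀.fromSpec p ∈ Y.basicOpen a ↔ a ∉ p.asIdeal := by
    intro p
    have := hV₀.fromSpec_preimage_basicOpen a
    have h2 : p ∈ hV₀.fromSpec ⁻¹ᵁ Y.basicOpen a ↔ p ∈ PrimeSpectrum.basicOpen a := by
      rw [this]; rfl
    exact h2
  refine ⟨Y.basicOpen a, ?_, Y.basicOpen_le a, fun u hu => ?_⟩
  · rw [← hbot, hmem]; exact fun h => ha (by simpa using h)
  · obtain ⟨p, rfl⟩ : u ∈ Set.range hV₀.fromSpec := by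
      rw [hV₀.range_fromSpec]; exact Y.basicOpen_le a hu
    exact (hdim p).trans_lt (hfa p ((hmem p).1 hu))

end Chart
/-- For a projective morphism `φ : V' → V` to an integral base with fibres
pure of dimension `m` and all generic points of `V'` above the generic point of `V`, there are
a dense open `U ⊆ V` and a horizontal divisor `D ⊆ V'_U` whose complement is a finite disjoint
union of irreducible pieces, each with pure, equidimensional fibres over `U`. -/
theorem statement9 (K : Type) [Field K] [IsAlgClosed K]
    (V' V : Variety K) (hV' : V'.IsQuasiProjective) (hV : V.IsQuasiProjective)
    (hVint : IsIntegral V.X)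
    (φ : V'.X ⟶ V.X) (hφK : φ ≫ V.structMap = V'.structMap)
    (hproj : IsProjectiveMorphism V' V φ)
    (m : ℕ) (hpure : ∀ u : V.X, IsPureOfDim (fiber φ u) (m : ℕ∞))
    -- the generic point of `V`
    (η : V.X) (hη : closure {η} = (Set.univ : Set V.X))
    -- every generic point of `V'` lies over the generic point of `V`
    (hgen : ∀ x : V'.X, closure {x} ∈ irreducibleComponents V'.X → φ.base x = η) :
    ∃ U : V.X.Opens, Dense (U : Set V.X) ∧
      ∃ D : Set V'.X,
        -- `D` is Zariski closed in `V'_U = φ⁻¹(U)`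
        (∃ Z : Set V'.X, IsClosed Z ∧ D = Z ∩ φ.base ⁻¹' (U : Set V.X)) ∧
        -- `D` is a horizontal divisor: it contains no irreducible component of
        -- any fibre of `φ` over `U`
        (∀ u : V.X, u ∈ U → ∀ T ∈ irreducibleComponents ↥(fiber φ u),
          ¬ (Subtype.val '' T ⊆ D)) ∧
        -- the complement `V'_U ∖ D` is a finite disjoint union of irreducible pieces,
        -- each with pure equidimensional fibres over every point of `U`
        ∃ (n : ℕ) (C : Fin n → Set V'.X) (d : Fin n → WithBot ℕ∞),
          (∀ i j, i ≠ j → Disjoint (C i) (C j)) ∧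
          (∀ i, IsIrreducible (C i)) ∧
          (⋃ i, C i) = (φ.base ⁻¹' (U : Set V.X)) \ D ∧
          (∀ i, IsOpen
            (Subtype.val ⁻¹' C i : Set ↥((φ.base ⁻¹' (U : Set V.X)) \ D))) ∧
          (∀ i, ∀ u : V.X, u ∈ U → IsPureOfDim ↥(C i ∩ fiber φ u) (d i)) := by
  have hlft' := V'.locallyOfFiniteType
  have hqc' := V'.quasiCompact
  have hlft : LocallyOfFiniteType φ := by
    have : LocallyOfFiniteType (φ ≫ V.structMap) := by rw [hφK]; exact hlft'
    exact locallyOfFiniteType_of_comp φ V.structMap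
  have hN1 : IsLocallyNoetherian V'.X := LocallyOfFiniteType.isLocallyNoetherian V'.structMap
  have hcomp : CompactSpace V'.X := QuasiCompact.compactSpace_of_compactSpace V'.structMap
  have hN2 : IsNoetherian V'.X := {}
  have hNS : NoetherianSpace V'.X := inferInstance
  have hfin : (irreducibleComponents V'.X).Finite := NoetherianSpace.finite_irreducibleComponents
  have : Finite (irreducibleComponents V'.X) := hfin
  obtain ⟨n, ⟨e⟩⟩ := Finite.exists_equiv_fin (irreducibleComponents V'.X)
  let c : Fin n → Set V'.X := fun i => (e.symm i).1
  have hcmem : ∀ i, c i ∈ irreducibleComponents V'.X := fun i => (e.symm i).2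
  have hccl : ∀ i, IsClosed (c i) := fun i => isClosed_of_mem_irreducibleComponents _ (hcmem i)
  have hcinj : ∀ i j, c i = c j → i = j := fun i j h => e.symm.injective (Subtype.ext h)
  have hcov : ∀ x : V'.X, ∃ i, x ∈ c i := by
    intro x
    refine ⟨e ⟨irreducibleComponent x, irreducibleComponent_mem_irreducibleComponents x⟩, ?_⟩
    simp only [c, Equiv.symm_apply_apply]
    exact mem_irreducibleComponent
  let Z : Set V'.X := ⋃ i, ⋃ j, ⋃ (_ : i ≠ j), c i ∩ c j
  have hZ : IsClosed Z := isClosed_iUnion_of_finite fun i => isClosed_iUnion_of_finite fun j =>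
    isClosed_iUnion_of_finite fun _ => (hccl i).inter (hccl j)
  have hZmem : ∀ x, x ∈ Z ↔ ∃ i j, i ≠ j ∧ x ∈ c i ∧ x ∈ c j := by
    intro x
    simp only [Z, Set.mem_iUnion, Set.mem_inter_iff, exists_prop]
  have hgenZ : ∀ x : V'.X, closure {x} ∈ irreducibleComponents V'.X → x ∉ Z := by
    intro x hx hxZ
    obtain ⟨i, j, hij, hi, hj⟩ := (hZmem x).1 hxZ
    have key : ∀ i, x ∈ c i → c i = closure {x} := by
      intro i hi
      have h1 : closure {x} ⊆ c i := (hccl i).closure_subset_iff.2 (by simpa using hi)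
      exact (hx.2 (hcmem i).1 h1).antisymm h1
    exact hij (hcinj _ _ ((key i hi).trans (key j hj).symm))
  -- dimension of `Z` in the generic fibre
  have hdimη : topologicalKrullDim ↥(Z ∩ fiber φ η) < (m : WithBot ℕ∞) := by
    have hq := sober_fiber φ η
    have h1 := dim_closed_lt m (hpure η) (Y := Subtype.val ⁻¹' Z)
      (hZ.preimage continuous_subtype_val) (by
        intro x hx
        apply hgenZ x.1
        rw [mem_comp_iff] at hx ⊢
        intro y hy
        have h2 : φ y ⤳ φ x.1 := hy.map φ.continuous
        have h3 : φ x.1 = η := x.2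
        have h4 : η ⤳ φ y := by rw [specializes_iff_mem_closure, hη]; trivial
        rw [h3] at h2
        have h5 : φ y = η := (h2.antisymm h4).eq
        have := hx ⟨y, h5⟩ (by rwa [← IsInducing.subtypeVal.specializes_iff])
        rwa [← IsInducing.subtypeVal.specializes_iff] at this)
    rw [← dim_image IsEmbedding.subtypeVal, Subtype.image_preimage_coe, Set.inter_comm] at h1
    exact h1
  obtain ⟨_, ⟨V₀, hV₀, rfl⟩, hηV, -⟩ := (V.X.isBasis_affineOpens).exists_subset_of_mem_open
    (Set.mem_univ η) isOpen_univ
  have hloc : ∀ x : ↥(φ ⁻¹ᵁ V₀), ∃ W : V'.X.Opens, IsAffineOpen W ∧ x.1 ∈ W ∧ W ≤ φ ⁻¹ᵁ V₀ := by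
    intro x
    obtain ⟨_, ⟨W, hW, rfl⟩, hxW, hWV⟩ := (V'.X.isBasis_affineOpens).exists_subset_of_mem_open
      x.2 (φ ⁻¹ᵁ V₀).2
    exact ⟨W, hW, hxW, hWV⟩
  choose W hWa hxW hWV using hloc
  have hUx : ∀ x : ↥(φ ⁻¹ᵁ V₀), ∃ U : V.X.Opens, η ∈ U ∧ U ≤ V₀ ∧ ∀ u ∈ U,
      topologicalKrullDim ↥(Z ∩ W x ∩ fiber φ u) < (m : WithBot ℕ∞) := fun x =>
    chart_open φ hV₀ (hWa x) (hWV x) hZ η hη hηV m ((dim_mono_set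
      (Set.inter_subset_inter_left _ Set.inter_subset_left)).trans_lt hdimη)
  choose Ux hηU hUV hUdim using hUx
  obtain ⟨t, ht⟩ := (NoetherianSpace.isCompact ((φ ⁻¹ᵁ V₀ : V'.X.Opens) : Set V'.X)).elim_finite_subcover
    (fun x => (W x : Set V'.X)) (fun x => (W x).2)
    (fun x hx => Set.mem_iUnion.2 ⟨⟨x, hx⟩, hxW ⟨x, hx⟩⟩)
  let U : V.X.Opens := ⟨(V₀ : Set V.X) ∩ ⋂ x ∈ t, (Ux x : Set V.X),
    V₀.2.inter (isOpen_biInter_finset fun x _ => (Ux x).2)⟩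
  have hUV₀ : ∀ u ∈ U, u ∈ V₀ := fun u hu => hu.1
  have hUUx : ∀ u ∈ U, ∀ x ∈ t, u ∈ Ux x := fun u hu x hx => Set.mem_iInter₂.1 hu.2 x hx
  have hηU' : η ∈ U := ⟨hηV, Set.mem_iInter₂.2 fun x _ => hηU x⟩
  have hpreU : IsOpen (φ.base ⁻¹' (U : Set V.X)) := U.2.preimage φ.continuous
  have hCo : ∀ i, IsOpen ((c i \ Z) ∩ φ.base ⁻¹' (U : Set V.X)) := by
    intro i
    refine IsOpen.inter ?_ hpreU
    have : c i \ Z = (Z ∪ ⋃ j, ⋃ (_ : j ≠ i), c j)ᶜ := by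
      ext x
      simp only [Set.mem_sdiff, Set.mem_compl_iff, Set.mem_union, not_or, Set.mem_iUnion,
        exists_prop, not_exists, not_and]
      constructor
      · rintro ⟨h1, h2⟩
        exact ⟨h2, fun j hj hxj => h2 ((hZmem x).2 ⟨j, i, hj, hxj, h1⟩)⟩
      · rintro ⟨h1, h2⟩
        obtain ⟨j, hj⟩ := hcov x
        by_cases hji : j = i
        · subst hji; exact ⟨hj, h1⟩
        · exact absurd hj (h2 j hji)
    rw [this, isOpen_compl_iff]
    exact hZ.union (isClosed_iUnion_of_finite fun j => isClosed_iUnion_of_finite fun _ => hccl j)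
  refine ⟨U, ?_, Z ∩ φ.base ⁻¹' (U : Set V.X), ⟨Z, hZ, rfl⟩, ?_, n,
    fun i => (c i \ Z) ∩ φ.base ⁻¹' (U : Set V.X), fun _ => ((m : ℕ∞) : WithBot ℕ∞),
    ?_, ?_, ?_, ?_, ?_⟩
  · have : Dense ({η} : Set V.X) := dense_iff_closure_eq.2 hη
    exact this.mono (by simpa using hηU')
  · intro u hu T hT hTD
    have hq := sober_fiber φ u
    have hdT := hpure u T hT
    obtain ⟨x, rfl⟩ := exists_gen_of_mem_comp hT
    have hxD : x.1 ∈ Z ∩ φ.base ⁻¹' (U : Set V.X) := hTD ⟨x, subset_closure rfl, rfl⟩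
    have hxu : φ x.1 = u := x.2
    have hxV : x.1 ∈ (φ ⁻¹ᵁ V₀ : V'.X.Opens) := by
      change φ x.1 ∈ V₀
      rw [hxu]; exact hUV₀ u hu
    obtain ⟨y, hy, hxy⟩ := Set.mem_iUnion₂.1 (ht hxV)
    have hP := propP_fiber φ u x (Subtype.val ⁻¹' (W y : Set V'.X))
      ((W y).2.preimage continuous_subtype_val) hxy
    rw [hdT, ← dim_image IsEmbedding.subtypeVal] at hP
    have hlt := hUdim y u (hUUx u hu y hy)
    have hle : topologicalKrullDim ↥(Subtype.val '' (closure {x} ∩ Subtype.val ⁻¹' (W y : Set V'.X)))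
        ≤ topologicalKrullDim ↥(Z ∩ W y ∩ fiber φ u) := by
      apply dim_mono_set
      rintro _ ⟨z, ⟨hz1, hz2⟩, rfl⟩
      exact ⟨⟨(hTD ⟨z, hz1, rfl⟩).1, hz2⟩, z.2⟩
    rw [hP] at hle
    exact absurd (hle.trans_lt hlt) (lt_irrefl _)
  · intro i j hij
    rw [Set.disjoint_left]
    rintro x ⟨⟨hi, hxZ⟩, -⟩ ⟨⟨hj, -⟩, -⟩
    exact hxZ ((hZmem x).2 ⟨i, j, hij, hi, hj⟩)
  · intro i
    obtain ⟨x, hx⟩ := exists_gen_of_mem_comp (hcmem i)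
    have hx' : closure {x} ∈ irreducibleComponents V'.X := hx ▸ hcmem i
    refine ⟨⟨x, ⟨⟨hx ▸ subset_closure rfl, hgenZ x hx'⟩, ?_⟩⟩, ?_⟩
    · change φ.base x ∈ U
      rw [hgen x hx']; exact hηU'
    · exact (hcmem i).1.2.open_subset (hCo i) fun z hz => hz.1.1
  · ext x
    simp only [Set.mem_iUnion, Set.mem_inter_iff, Set.mem_sdiff]
    constructor
    · rintro ⟨i, ⟨h1, h2⟩, h3⟩
      exact ⟨h3, fun h => h2 h.1⟩
    · rintro ⟨h3, h2⟩
      obtain ⟨i, hi⟩ := hcov x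
      exact ⟨i, ⟨hi, fun h => h2 ⟨h, h3⟩⟩, h3⟩
  · intro i
    exact (hCo i).preimage continuous_subtype_val
  · intro i u hu
    have hq := sober_fiber φ u
    have h1 := IsPureOfDim.open_sub (propP_fiber φ u) (hpure u)
      ((hCo i).preimage (continuous_subtype_val (p := fun x => x ∈ fiber φ u)))
    refine IsPureOfDim.of_homeo ((IsEmbedding.subtypeVal.homeomorphImage _).trans
      (Homeomorph.setCongr ?_)) h1
    rw [Subtype.image_preimage_coe, Set.inter_comm]

end HLpaper
end
end
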